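/- For every d ≥ 11, the graph H_d on n = 3d vertices admits a planar straight-line grid drawing of height 4 but admits no planar straight-line grid drawing of height at most 3; consequently every planar straight-line grid drawing of H_d of minimum height has area (width times height) at least (4/3)·2^d, which is exponential in n. -/

import Mathlib

open Set

noncomputable section

/-- Points of the plane. -/
abbrev Pt : Type := ℝ × ℝ

/-- The image (set of points) of a polygonal chain given by its list of breakpoints. -/
def chainSet : List Pt → Set Pt
  | [] => ∅
  | [p] => {p}
  | p :: q :: rest => segment ℝ p q ∪ chainSet (q :: rest)

/-- The bends (interior junction points) of a polygonal chain. -/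
def chainBends (l : List Pt) : List Pt := (l.drop 1).dropLast

/-- `S` is the image of a simple (injective) curve from `a` to `b`. -/
def IsSimpleArc (S : Set Pt) (a b : Pt) : Prop :=
  ∃ γ : ℝ → Pt, ContinuousOn γ (Icc (0:ℝ) 1) ∧ InjOn γ (Icc (0:ℝ) 1) ∧
    γ '' Icc (0:ℝ) 1 = S ∧ γ 0 = a ∧ γ 1 = b

/-- A poly-line drawing of a simple graph `G`: an injective placement of the vertices
together with, for each edge, a simple polygonal arc joining the endpoints. -/
structure PolyDrawing {V : Type} (G : SimpleGraph V) where
  pos : V → Pt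
  pos_inj : Function.Injective pos
  arc : Sym2 V → List Pt
  arc_ends : ∀ u v : V, G.Adj u v →
    ((arc s(u, v)).head? = some (pos u) ∧ (arc s(u, v)).getLast? = some (pos v)) ∨
    ((arc s(u, v)).head? = some (pos v) ∧ (arc s(u, v)).getLast? = some (pos u))
  arc_simple : ∀ u v : V, G.Adj u v →
    IsSimpleArc (chainSet (arc s(u, v))) (pos u) (pos v)

namespace PolyDrawing

variable {V : Type} {G : SimpleGraph V}

/-- The set of points used by the arc of an edge. -/
def edgePts (Γ : PolyDrawing G) (e : Sym2 V) : Set Pt := chainSet (Γ.arc e)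

/-- Planarity: no vertex point lies on the arc of a non-incident edge, and arcs of
distinct edges meet only in images of common endpoints. -/
def IsPlanar (Γ : PolyDrawing G) : Prop :=
  (∀ v : V, ∀ e ∈ G.edgeSet, v ∉ e → Γ.pos v ∉ Γ.edgePts e) ∧
  (∀ e ∈ G.edgeSet, ∀ f ∈ G.edgeSet, e ≠ f →
    ∀ p ∈ Γ.edgePts e ∩ Γ.edgePts f, ∃ w : V, w ∈ e ∧ w ∈ f ∧ p = Γ.pos w)

/-- `y`-monotone: along every edge arc the `y`-coordinate varies weakly monotonically. -/
def IsYMonotone (Γ : PolyDrawing G) : Prop :=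
  ∀ e ∈ G.edgeSet,
    List.Chain' (· ≤ ·) ((Γ.arc e).map Prod.snd) ∨
    List.Chain' (· ≥ ·) ((Γ.arc e).map Prod.snd)

/-- The drawing has height `h`: every vertex and every bend has an integer
`y`-coordinate in `{1, …, h}`. -/
def HasHeight (Γ : PolyDrawing G) (h : ℕ) : Prop :=
  (∀ v : V, ∃ k : ℤ, 1 ≤ k ∧ k ≤ (h : ℤ) ∧ (Γ.pos v).2 = (k : ℝ)) ∧
  (∀ e ∈ G.edgeSet, ∀ p ∈ chainBends (Γ.arc e), ∃ k : ℤ, 1 ≤ k ∧ k ≤ (h : ℤ) ∧ p.2 = (k : ℝ))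

/-- All vertices and bends have integer `y`-coordinates. -/
def IntegerY (Γ : PolyDrawing G) : Prop :=
  (∀ v : V, ∃ k : ℤ, (Γ.pos v).2 = (k : ℝ)) ∧
  (∀ e ∈ G.edgeSet, ∀ p ∈ chainBends (Γ.arc e), ∃ k : ℤ, p.2 = (k : ℝ))

/-- The set of all points of the drawing (vertex points and edge arcs). -/
def image (Γ : PolyDrawing G) : Set Pt :=
  Set.range Γ.pos ∪ ⋃ e ∈ G.edgeSet, Γ.edgePts e

/-- The union of the unbounded connected components of the complement of the drawing. -/
def outerRegion (Γ : PolyDrawing G) : Set Pt :=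
  {p | p ∉ Γ.image ∧ ¬ Bornology.IsBounded (connectedComponentIn Γ.imageᶜ p)}

/-- A vertex is inner if its point does not lie on the boundary of the unbounded
connected component of the complement of the drawing. -/
def IsInner (Γ : PolyDrawing G) (v : V) : Prop :=
  Γ.pos v ∉ frontier Γ.outerRegion

/-- Number of incoming edges at `v` (edges whose other endpoint is weakly below `v`;
horizontal edges count as incoming). -/
def indeg (Γ : PolyDrawing G) (v : V) : ℕ :=
  {w : V | G.Adj v w ∧ (Γ.pos w).2 ≤ (Γ.pos v).2}.ncard

/-- Number of outgoing edges at `v` (edges whose other endpoint is weakly above `v`;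
horizontal edges count as outgoing). -/
def outdeg (Γ : PolyDrawing G) (v : V) : ℕ :=
  {w : V | G.Adj v w ∧ (Γ.pos v).2 ≤ (Γ.pos w).2}.ncard

/-- The set of points drawn for an element (vertex or edge) of the graph. -/
def drawSet (Γ : PolyDrawing G) : V ⊕ ↥G.edgeSet → Set Pt
  | Sum.inl v => {Γ.pos v}
  | Sum.inr e => Γ.edgePts e

end PolyDrawing

/-- A straight-line drawing of a simple graph: an injective placement of the vertices;
each edge is drawn as the closed segment between its endpoints. -/
structure StraightDrawing {V : Type} (G : SimpleGraph V) where
  pos : V → Pt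
  pos_inj : Function.Injective pos

namespace StraightDrawing

variable {V : Type} {G : SimpleGraph V}

/-- The closed segment representing an edge. -/
def edgePts (Γ : StraightDrawing G) (e : Sym2 V) : Set Pt :=
  Sym2.lift ⟨fun u v => segment ℝ (Γ.pos u) (Γ.pos v),
    fun u v => segment_symm (𝕜 := ℝ) (Γ.pos u) (Γ.pos v)⟩ e

/-- Planarity of a straight-line drawing. -/
def IsPlanar (Γ : StraightDrawing G) : Prop :=
  (∀ v : V, ∀ e ∈ G.edgeSet, v ∉ e → Γ.pos v ∉ Γ.edgePts e) ∧
  (∀ e ∈ G.edgeSet, ∀ f ∈ G.edgeSet, e ≠ f →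
    ∀ p ∈ Γ.edgePts e ∩ Γ.edgePts f, ∃ w : V, w ∈ e ∧ w ∈ f ∧ p = Γ.pos w)

/-- Every vertex has an integer `y`-coordinate in `{1, …, h}`. -/
def HeightLe (Γ : StraightDrawing G) (h : ℕ) : Prop :=
  ∀ v : V, ∃ k : ℤ, 1 ≤ k ∧ k ≤ (h : ℤ) ∧ (Γ.pos v).2 = (k : ℝ)

/-- All vertices lie on integer grid points. -/
def IsGrid (Γ : StraightDrawing G) : Prop :=
  ∀ v : V, ∃ p : ℤ × ℤ, Γ.pos v = ((p.1 : ℝ), (p.2 : ℝ))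

/-- The set of points drawn for an element (vertex or edge) of the graph. -/
def drawSet (Γ : StraightDrawing G) : V ⊕ ↥G.edgeSet → Set Pt
  | Sum.inl v => {Γ.pos v}
  | Sum.inr e => Γ.edgePts e

end StraightDrawing

/-- The intersection of a set of points with the horizontal line `y = r`,
recorded as a set of `x`-coordinates. -/
def rowSlice (S : Set Pt) (r : ℝ) : Set ℝ := {x : ℝ | (x, r) ∈ S}

/-- Two drawings (given by the sets drawn for each vertex/edge element) have the same
left-to-right order in each row: for every integer row `r` and elements `a`, `b` both
meeting row `r` in both drawings, the drawing of `a` lies entirely strictly to the left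
of that of `b` in one drawing iff it does in the other. -/
def SameRowOrder {α : Type} (D D' : α → Set Pt) : Prop :=
  ∀ r : ℤ, ∀ a b : α,
    (rowSlice (D a) (r : ℝ)).Nonempty → (rowSlice (D b) (r : ℝ)).Nonempty →
    (rowSlice (D' a) (r : ℝ)).Nonempty → (rowSlice (D' b) (r : ℝ)).Nonempty →
    ((∀ x ∈ rowSlice (D a) (r : ℝ), ∀ y ∈ rowSlice (D b) (r : ℝ), x < y) ↔
     (∀ x ∈ rowSlice (D' a) (r : ℝ), ∀ y ∈ rowSlice (D' b) (r : ℝ), x < y))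

/-- A simple graph on `n ≥ 3` vertices is triangulated (maximal planar) if it admits a
planar poly-line drawing and has exactly `3n - 6` edges. -/
def IsTriangulated {V : Type} [Fintype V] (G : SimpleGraph V) : Prop :=
  3 ≤ Fintype.card V ∧ G.edgeSet.ncard = 3 * Fintype.card V - 6 ∧
  ∃ Γ : PolyDrawing G, Γ.IsPlanar

/-- Data of a flat visibility representation: a horizontal segment for every vertex
(given by its `y`-coordinate and left/right `x`-coordinates) and a segment (given by
its two endpoints) for every edge. -/
structure VisData (V : Type) where
  ly : V → ℝ
  lx : V → ℝ
  rx : V → ℝ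
  ep1 : Sym2 V → Pt
  ep2 : Sym2 V → Pt

/-- The horizontal segment of a vertex. -/
def VisData.vseg {V : Type} (D : VisData V) (v : V) : Set Pt :=
  segment ℝ (D.lx v, D.ly v) (D.rx v, D.ly v)

/-- The segment of an edge. -/
def VisData.eseg {V : Type} (D : VisData V) (e : Sym2 V) : Set Pt :=
  segment ℝ (D.ep1 e) (D.ep2 e)

/-- `D` is a planar flat visibility representation of `G` of height `h`. -/
def IsFlatVisRep {V : Type} (G : SimpleGraph V) (D : VisData V) (h : ℕ) : Prop :=
  (∀ v : V, D.lx v ≤ D.rx v) ∧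
  (∀ v : V, ∃ k : ℤ, 1 ≤ k ∧ k ≤ (h : ℤ) ∧ D.ly v = (k : ℝ)) ∧
  (∀ e ∈ G.edgeSet, (D.ep1 e).1 = (D.ep2 e).1 ∨ (D.ep1 e).2 = (D.ep2 e).2) ∧
  (∀ e ∈ G.edgeSet, ∀ p ∈ D.eseg e, 1 ≤ p.2 ∧ p.2 ≤ (h : ℝ)) ∧
  (∀ u v : V, G.Adj u v →
    (D.ep1 s(u, v) ∈ D.vseg u ∧ D.ep2 s(u, v) ∈ D.vseg v) ∨
    (D.ep1 s(u, v) ∈ D.vseg v ∧ D.ep2 s(u, v) ∈ D.vseg u)) ∧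
  (∀ u v : V, u ≠ v → Disjoint (D.vseg u) (D.vseg v)) ∧
  (∀ e ∈ G.edgeSet, ∀ w : V, ∀ p ∈ D.eseg e ∩ D.vseg w, p = D.ep1 e ∨ p = D.ep2 e) ∧
  (∀ e ∈ G.edgeSet, ∀ f ∈ G.edgeSet, e ≠ f → ∀ p ∈ D.eseg e ∩ D.eseg f,
    (p = D.ep1 e ∨ p = D.ep2 e) ∧ (p = D.ep1 f ∨ p = D.ep2 f))

end

/-- Vertices of the graph `H_d`: `u`, `v`, path vertices `a_0, …, a_{d-1}`
(representing `a_1, …, a_d`), and added vertices `b_i`, `c_i` for `0 ≤ i ≤ d - 2`. -/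
inductive HVert (d : ℕ) : Type where
  | u : HVert d
  | v : HVert d
  | a : Fin d → HVert d
  | b : Fin (d - 1) → HVert d
  | c : Fin (d - 1) → HVert d
deriving DecidableEq

/-- Base relation generating the edges of `H_d`. -/
def HRel (d : ℕ) : HVert d → HVert d → Prop
  | .u, .v => True
  | .u, .a _ => True
  | .v, .a _ => True
  | .a i, .a j => (j : ℕ) = (i : ℕ) + 1
  | .b _, .u => True
  | .b i, .a j => (j : ℕ) = (i : ℕ) ∨ (j : ℕ) = (i : ℕ) + 1
  | .c _, .v => True
  | .c i, .a j => (j : ℕ) = (i : ℕ) ∨ (j : ℕ) = (i : ℕ) + 1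
  | _, _ => False

/-- The graph `H_d` on `n = 3d` vertices: `G_d` (the vertices `u`, `v`, the path
`a_1 … a_d`, with `u`, `v` adjacent to each other and to all `a_i`) together with the
vertices `b_i` adjacent exactly to `u, a_i, a_{i+1}` and `c_i` adjacent exactly to
`v, a_i, a_{i+1}`. -/
def Hgraph (d : ℕ) : SimpleGraph (HVert d) := SimpleGraph.fromRel (HRel d)

/-- Twice the signed area of the triangle `p q r`. -/
def orient {R : Type*} [CommRing R] (p q r : R × R) : R :=
  (q.1 - p.1) * (r.2 - p.2) - (q.2 - p.2) * (r.1 - p.1)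

/-- The point `x` lies strictly inside the triangle `p q r` (of either orientation). -/
def InTri {R : Type*} [CommRing R] [LinearOrder R] (p q r x : R × R) : Prop :=
  (0 < orient p q x ∧ 0 < orient q r x ∧ 0 < orient r p x) ∨
    (orient p q x < 0 ∧ orient q r x < 0 ∧ orient r p x < 0)

theorem orient_swap {R : Type*} [CommRing R] (p q r : R × R) : orient q p r = -orient p q r := by
  simp only [orient]; ring

theorem orient_rotate {R : Type*} [CommRing R] (p q r : R × R) : orient q r p = orient p q r := by
  simp only [orient]; ring

theorem orient_add {R : Type*} [CommRing R] (p q r x : R × R) :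
    orient p q x + orient q r x + orient r p x = orient p q r := by
  simp only [orient]; ring

theorem InTri.swap {R : Type*} [CommRing R] [LinearOrder R] [IsStrictOrderedRing R]
    {p q r x : R × R} (h : InTri p q r x) : InTri q p r x := by
  unfold InTri at *
  rw [orient_swap p q, orient_swap r p, orient_swap q r]
  simp only [Left.neg_pos_iff, Left.neg_neg_iff]
  tauto

theorem InTri.rotate {R : Type*} [CommRing R] [LinearOrder R]
    {p q r x : R × R} (h : InTri p q r x) : InTri q r p x := by
  unfold InTri at *
  tauto

theorem InTri.snd_lt {R : Type*} [CommRing R] [LinearOrder R] [IsStrictOrderedRing R]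
    {p q r x : R × R} (h : InTri p q r x) : x.2 < p.2 ∨ x.2 < q.2 ∨ x.2 < r.2 := by
  have key : orient q r x * (p.2 - x.2) + orient r p x * (q.2 - x.2)
      + orient p q x * (r.2 - x.2) = 0 := by
    simp only [orient]; ring
  by_contra! hc
  obtain ⟨h1, h2, h3⟩ := hc
  have hs := orient_add p q r x
  have aux : ∀ s : R, s = orient p q r → s ≠ 0 → ¬ (p.2 = x.2 ∧ q.2 = x.2 ∧ r.2 = x.2) := by
    rintro s rfl hs0 ⟨e1, e2, e3⟩
    apply hs0
    simp only [orient, e1, e2, e3]; ring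
  rcases h with ⟨a1, a2, a3⟩ | ⟨a1, a2, a3⟩
  · have b1 := mul_nonneg a2.le (sub_nonneg.2 h1)
    have b2 := mul_nonneg a3.le (sub_nonneg.2 h2)
    have b3 := mul_nonneg a1.le (sub_nonneg.2 h3)
    refine aux _ hs (by linarith) ⟨?_, ?_, ?_⟩
    · have : orient q r x * (x.2 - p.2) = 0 := by linarith
      rcases mul_eq_zero.1 this with h | h <;> linarith
    · have : orient r p x * (x.2 - q.2) = 0 := by linarith
      rcases mul_eq_zero.1 this with h | h <;> linarith
    · have : orient p q x * (x.2 - r.2) = 0 := by linarith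
      rcases mul_eq_zero.1 this with h | h <;> linarith
  · have b1 := mul_nonneg (neg_pos.2 a2).le (sub_nonneg.2 h1)
    have b2 := mul_nonneg (neg_pos.2 a3).le (sub_nonneg.2 h2)
    have b3 := mul_nonneg (neg_pos.2 a1).le (sub_nonneg.2 h3)
    refine aux _ hs (by linarith) ⟨?_, ?_, ?_⟩
    · have : orient q r x * (x.2 - p.2) = 0 := by linarith
      rcases mul_eq_zero.1 this with h | h <;> linarith
    · have : orient r p x * (x.2 - q.2) = 0 := by linarith
      rcases mul_eq_zero.1 this with h | h <;> linarith
    · have : orient p q x * (x.2 - r.2) = 0 := by linarith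
      rcases mul_eq_zero.1 this with h | h <;> linarith

/-- Reflection in the horizontal axis. -/
def flipY {R : Type*} [CommRing R] (p : R × R) : R × R := (p.1, -p.2)

theorem InTri.flipY {R : Type*} [CommRing R] [LinearOrder R] [IsStrictOrderedRing R]
    {p q r x : R × R} (h : InTri p q r x) : InTri (flipY p) (flipY q) (flipY r) (flipY x) := by
  have e : ∀ p q r : R × R, orient (_root_.flipY p) (_root_.flipY q) (_root_.flipY r)
      = -orient p q r := by
    intro p q r; simp only [orient, _root_.flipY]; ring
  unfold InTri at *
  rw [e, e, e]
  simp only [Left.neg_pos_iff, Left.neg_neg_iff]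
  tauto

theorem InTri.lt_snd {R : Type*} [CommRing R] [LinearOrder R] [IsStrictOrderedRing R]
    {p q r x : R × R} (h : InTri p q r x) : p.2 < x.2 ∨ q.2 < x.2 ∨ r.2 < x.2 := by
  simpa [_root_.flipY] using h.flipY.snd_lt

theorem mem_segment_iff_exists {p q x : Pt} : x ∈ segment ℝ p q ↔
    ∃ t : ℝ, 0 ≤ t ∧ t ≤ 1 ∧ x.1 = p.1 + t * (q.1 - p.1) ∧ x.2 = p.2 + t * (q.2 - p.2) := by
  rw [segment_eq_image']
  constructor
  · rintro ⟨t, ⟨h0, h1⟩, rfl⟩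
    exact ⟨t, h0, h1, by simp, by simp⟩
  · rintro ⟨t, h0, h1, h2, h3⟩
    exact ⟨t, ⟨h0, h1⟩, by ext <;> simp [h2, h3]⟩

/-- A point on the line of one side of a triangle and weakly inside the other two sides
lies on that side. -/
theorem mem_segment_of_orient_eq_zero {p q r x : Pt} (h0 : 0 < orient p q r)
    (h1 : orient p q x = 0) (h2 : 0 ≤ orient q r x) (h3 : 0 ≤ orient r p x) :
    x ∈ segment ℝ p q := by
  have hs := orient_add p q r x
  have e1 : orient p q r * (x.1 - p.1) = orient r p x * (q.1 - p.1) := by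
    have : orient p q r * (x.1 - p.1) - orient r p x * (q.1 - p.1)
      = orient p q x * (r.1 - p.1) := by simp only [orient]; ring
    rw [h1] at this; linarith
  have e2 : orient p q r * (x.2 - p.2) = orient r p x * (q.2 - p.2) := by
    have : orient p q r * (x.2 - p.2) - orient r p x * (q.2 - p.2)
      = orient p q x * (r.2 - p.2) := by simp only [orient]; ring
    rw [h1] at this; linarith
  refine mem_segment_iff_exists.2 ⟨orient r p x / orient p q r, by positivity, ?_, ?_, ?_⟩
  · rw [div_le_one h0]; linarith
  · field_simp; linarith
  · field_simp; linarith

/-- Segments whose endpoints are separated by each other's lines intersect. -/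
theorem exists_mem_segment_of_orient {p q r s : Pt} (h1 : 0 < orient p q r)
    (h2 : orient p q s < 0) (h3 : 0 < orient r s q) (h4 : orient r s p < 0) :
    ∃ x, x ∈ segment ℝ p q ∧ x ∈ segment ℝ r s := by
  have hd : 0 < orient p q r - orient p q s := by linarith
  have he : orient r s q - orient r s p = orient p q r - orient p q s := by
    simp only [orient]; ring
  refine ⟨(r.1 + orient p q r / (orient p q r - orient p q s) * (s.1 - r.1),
    r.2 + orient p q r / (orient p q r - orient p q s) * (s.2 - r.2)), ?_, ?_⟩
  · refine mem_segment_iff_exists.2 ⟨-orient r s p / (orient p q r - orient p q s), ?_, ?_, ?_, ?_⟩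
    · apply div_nonneg <;> linarith
    · rw [div_le_one hd]; linarith
    · field_simp; simp only [orient]; ring
    · field_simp; simp only [orient]; ring
  · refine mem_segment_iff_exists.2 ⟨orient p q r / (orient p q r - orient p q s), ?_, ?_, rfl, rfl⟩
    · positivity
    · rw [div_le_one hd]; linarith

theorem exists_mem_first_side {p q r x y : Pt} (hpos : 0 < orient p q r) (h1 : 0 < orient p q x)
    (hy : orient p q y / orient p q x ≤ 0) (h2 : 0 < orient q r x) (h3 : 0 < orient r p x)
    (h4 : orient p q y / orient p q x ≤ orient q r y / orient q r x)
    (h5 : orient p q y / orient p q x ≤ orient r p y / orient r p x) :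
    ∃ z ∈ segment ℝ x y, z ∈ segment ℝ p q := by
  have aff : ∀ (a b : Pt) (t : ℝ), orient a b (x.1 + t * (y.1 - x.1), x.2 + t * (y.2 - x.2))
      = orient a b x + t * (orient a b y - orient a b x) := by
    intro a b t; simp only [orient]; ring
  rw [div_le_iff₀ h1, zero_mul] at hy
  rw [div_le_div_iff₀ h1 h2] at h4
  rw [div_le_div_iff₀ h1 h3] at h5
  have hd : 0 < orient p q x - orient p q y := by linarith
  have ht : orient p q x / (orient p q x - orient p q y) ≤ 1 := by
    rw [div_le_one hd]; linarith
  refine ⟨(x.1 + orient p q x / (orient p q x - orient p q y) * (y.1 - x.1),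
    x.2 + orient p q x / (orient p q x - orient p q y) * (y.2 - x.2)), mem_segment_iff_exists.2
    ⟨orient p q x / (orient p q x - orient p q y), by positivity, ht, rfl, rfl⟩, ?_⟩
  apply mem_segment_of_orient_eq_zero hpos <;> rw [aff]
  · field_simp; ring
  · have : orient q r x + orient p q x / (orient p q x - orient p q y) *
        (orient q r y - orient q r x) = (orient q r y * orient p q x - orient p q y * orient q r x)
        / (orient p q x - orient p q y) := by field_simp; ring
    rw [this]; apply div_nonneg <;> linarith
  · have : orient r p x + orient p q x / (orient p q x - orient p q y) *
        (orient r p y - orient r p x) = (orient r p y * orient p q x - orient p q y * orient r p x)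
        / (orient p q x - orient p q y) := by field_simp; ring
    rw [this]; apply div_nonneg <;> linarith

/-- A segment leaving the interior of a triangle meets one of its sides. -/
theorem exists_mem_side_of_pos {p q r x y : Pt} (h1 : 0 < orient p q x) (h2 : 0 < orient q r x)
    (h3 : 0 < orient r p x) (hy : ¬ InTri p q r y) :
    ∃ z ∈ segment ℝ x y, z ∈ segment ℝ p q ∨ z ∈ segment ℝ q r ∨ z ∈ segment ℝ r p := by
  have hpos : 0 < orient p q r := by linarith [orient_add p q r x]
  have hq : 0 < orient q r p := by rwa [orient_rotate]
  have hr : 0 < orient r p q := by rwa [orient_rotate, orient_rotate]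
  have c : orient p q y ≤ 0 ∨ orient q r y ≤ 0 ∨ orient r p y ≤ 0 := by
    by_contra! hc
    exact hy (Or.inl hc)
  have least : ∀ a b c : ℝ, (a ≤ 0 ∨ b ≤ 0 ∨ c ≤ 0) → (a ≤ 0 ∧ a ≤ b ∧ a ≤ c) ∨
      (b ≤ 0 ∧ b ≤ c ∧ b ≤ a) ∨ (c ≤ 0 ∧ c ≤ a ∧ c ≤ b) := by
    intro a b c h
    grind
  have c' := least _ _ _ (c.imp (div_nonpos_of_nonpos_of_nonneg · h1.le)
    (Or.imp (div_nonpos_of_nonpos_of_nonneg · h2.le) (div_nonpos_of_nonpos_of_nonneg · h3.le)))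
  rcases c' with ⟨e1, e2, e3⟩ | ⟨e1, e2, e3⟩ | ⟨e1, e2, e3⟩
  · obtain ⟨z, z1, z2⟩ := exists_mem_first_side hpos h1 e1 h2 h3 e2 e3
    exact ⟨z, z1, Or.inl z2⟩
  · obtain ⟨z, z1, z2⟩ := exists_mem_first_side hq h2 e1 h3 h1 e2 e3
    exact ⟨z, z1, Or.inr (Or.inl z2)⟩
  · obtain ⟨z, z1, z2⟩ := exists_mem_first_side hr h3 e1 h1 h2 e2 e3
    exact ⟨z, z1, Or.inr (Or.inr z2)⟩

theorem exists_mem_side {p q r x y : Pt} (hx : InTri p q r x) (hy : ¬ InTri p q r y) :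
    ∃ z ∈ segment ℝ x y, z ∈ segment ℝ p q ∨ z ∈ segment ℝ q r ∨ z ∈ segment ℝ r p := by
  rcases hx with ⟨h1, h2, h3⟩ | ⟨h1, h2, h3⟩
  · exact exists_mem_side_of_pos h1 h2 h3 hy
  · rw [← neg_pos, ← orient_swap] at h1 h2 h3
    obtain ⟨z, hz, h⟩ := exists_mem_side_of_pos h1 h3 h2 (fun h => hy h.swap)
    refine ⟨z, hz, ?_⟩
    rwa [segment_symm ℝ p q, segment_symm ℝ q r, segment_symm ℝ r p,
      or_comm (a := z ∈ segment ℝ r q)]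

namespace StraightDrawing

variable {V : Type} {G : SimpleGraph V} {Γ : StraightDrawing G}

theorem IsPlanar.notMem_segment (h : Γ.IsPlanar) {p q x : V} (hpq : G.Adj p q) (hp : x ≠ p)
    (hq : x ≠ q) : Γ.pos x ∉ segment ℝ (Γ.pos p) (Γ.pos q) :=
  h.1 x s(p, q) hpq (by simp [hp, hq])

theorem IsPlanar.disjoint_segment (h : Γ.IsPlanar) {p q r s : V} (hpq : G.Adj p q)
    (hrs : G.Adj r s) (hpr : p ≠ r) (hps : p ≠ s) (hqr : q ≠ r) (hqs : q ≠ s) :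
    ¬ ∃ x, x ∈ segment ℝ (Γ.pos p) (Γ.pos q) ∧ x ∈ segment ℝ (Γ.pos r) (Γ.pos s) := by
  rintro ⟨x, hx⟩
  have hne : s(p, q) ≠ s(r, s) := by simp [hpr, hps]
  obtain ⟨w, h1, h2, -⟩ := h.2 s(p, q) hpq s(r, s) hrs hne x hx
  simp only [Sym2.mem_iff] at h1 h2
  rcases h1 with rfl | rfl <;> rcases h2 with h2 | h2 <;> contradiction

/-- The interior of a triangle of the graph is a union of faces: adjacent vertices off the
triangle are both inside or both outside. -/
theorem IsPlanar.inTri_of_adj (h : Γ.IsPlanar) {p q r x y : V} (hpq : G.Adj p q)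
    (hqr : G.Adj q r) (hrp : G.Adj r p) (hxy : G.Adj x y) (hx1 : x ≠ p) (hx2 : x ≠ q)
    (hx3 : x ≠ r) (hy1 : y ≠ p) (hy2 : y ≠ q) (hy3 : y ≠ r)
    (hx : InTri (Γ.pos p) (Γ.pos q) (Γ.pos r) (Γ.pos x)) :
    InTri (Γ.pos p) (Γ.pos q) (Γ.pos r) (Γ.pos y) := by
  by_contra hy
  obtain ⟨z, hz, h1 | h1 | h1⟩ := exists_mem_side hx hy
  · exact h.disjoint_segment hxy hpq hx1 hx2 hy1 hy2 ⟨z, hz, h1⟩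
  · exact h.disjoint_segment hxy hqr hx2 hx3 hy2 hy3 ⟨z, hz, h1⟩
  · exact h.disjoint_segment hxy hrp hx3 hx1 hy3 hy1 ⟨z, hz, h1⟩

theorem IsPlanar.pos_of_nonneg (h : Γ.IsPlanar) {p q r x : V} (hpq : G.Adj p q)
    (hqr : G.Adj q r) (hrp : G.Adj r p) (hx1 : x ≠ p) (hx2 : x ≠ q) (hx3 : x ≠ r)
    (h0 : 0 < orient (Γ.pos p) (Γ.pos q) (Γ.pos r))
    (h1 : 0 ≤ orient (Γ.pos p) (Γ.pos q) (Γ.pos x))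
    (h2 : 0 ≤ orient (Γ.pos q) (Γ.pos r) (Γ.pos x))
    (h3 : 0 ≤ orient (Γ.pos r) (Γ.pos p) (Γ.pos x)) :
    InTri (Γ.pos p) (Γ.pos q) (Γ.pos r) (Γ.pos x) := by
  have hq : 0 < orient (Γ.pos q) (Γ.pos r) (Γ.pos p) := by rwa [orient_rotate]
  have hr : 0 < orient (Γ.pos r) (Γ.pos p) (Γ.pos q) := by rwa [orient_rotate, orient_rotate]
  refine Or.inl ⟨lt_of_le_of_ne h1 fun e => ?_, lt_of_le_of_ne h2 fun e => ?_,
    lt_of_le_of_ne h3 fun e => ?_⟩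
  · exact h.notMem_segment hpq hx1 hx2 (mem_segment_of_orient_eq_zero h0 e.symm h2 h3)
  · exact h.notMem_segment hqr hx2 hx3 (mem_segment_of_orient_eq_zero hq e.symm h3 h1)
  · exact h.notMem_segment hrp hx3 hx1 (mem_segment_of_orient_eq_zero hr e.symm h1 h2)

theorem IsPlanar.orient_ne_zero (h : Γ.IsPlanar) {p q r : V} (hpq : G.Adj p q)
    (hqr : G.Adj q r) (hrp : G.Adj r p) : orient (Γ.pos p) (Γ.pos q) (Γ.pos r) ≠ 0 := by
  intro h0
  have hcol : Collinear ℝ {Γ.pos p, Γ.pos q, Γ.pos r} := by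
    have hne : Γ.pos p ≠ Γ.pos q := fun e => hpq.ne (Γ.pos_inj e)
    rw [collinear_iff_of_mem (p₀ := Γ.pos p) (by simp)]
    refine ⟨Γ.pos q - Γ.pos p, ?_⟩
    have hN : 0 < ((Γ.pos q).1 - (Γ.pos p).1) ^ 2 + ((Γ.pos q).2 - (Γ.pos p).2) ^ 2 := by
      by_contra! hle
      apply hne
      ext <;> nlinarith [sq_nonneg ((Γ.pos q).1 - (Γ.pos p).1),
        sq_nonneg ((Γ.pos q).2 - (Γ.pos p).2)]
    simp only [mem_insert_iff, mem_singleton_iff, forall_eq_or_imp, forall_eq]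
    refine ⟨⟨0, by simp⟩, ⟨1, by simp⟩, ⟨(((Γ.pos r).1 - (Γ.pos p).1) *
      ((Γ.pos q).1 - (Γ.pos p).1) + ((Γ.pos r).2 - (Γ.pos p).2) *
      ((Γ.pos q).2 - (Γ.pos p).2)) / (((Γ.pos q).1 - (Γ.pos p).1) ^ 2
      + ((Γ.pos q).2 - (Γ.pos p).2) ^ 2), ?_⟩⟩
    simp only [orient] at h0
    ext
    · simp only [vadd_eq_add, Prod.fst_add, Prod.smul_fst, Prod.fst_sub, smul_eq_mul]
      field_simp
      linear_combination -((Γ.pos q).2 - (Γ.pos p).2) * h0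
    · simp only [vadd_eq_add, Prod.snd_add, Prod.smul_snd, Prod.snd_sub, smul_eq_mul]
      field_simp
      linear_combination ((Γ.pos q).1 - (Γ.pos p).1) * h0
  rcases hcol.wbtw_or_wbtw_or_wbtw with e | e | e <;> rw [← mem_segment_iff_wbtw] at e
  · exact h.notMem_segment hrp.symm hpq.ne' hqr.ne e
  · exact h.notMem_segment hpq.symm hqr.ne' hrp.ne e
  · exact h.notMem_segment hqr.symm hrp.ne' hpq.ne e

/-- Two common neighbours of adjacent vertices, on the same side of their edge, are nested. -/
theorem IsPlanar.nested_of_pos (h : Γ.IsPlanar) {u v a a' : V} (huv : G.Adj u v)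
    (hua : G.Adj u a) (hva : G.Adj v a) (hua' : G.Adj u a') (hva' : G.Adj v a') (hne : a ≠ a')
    (ha : 0 < orient (Γ.pos u) (Γ.pos v) (Γ.pos a))
    (ha' : 0 < orient (Γ.pos u) (Γ.pos v) (Γ.pos a')) :
    InTri (Γ.pos u) (Γ.pos v) (Γ.pos a) (Γ.pos a') ∨
      InTri (Γ.pos u) (Γ.pos v) (Γ.pos a') (Γ.pos a) := by
  have w1 := h.pos_of_nonneg huv hva hua.symm hua'.ne' hva'.ne' hne.symm ha ha'.le
  have w2 := h.pos_of_nonneg huv hva' hua'.symm hua.ne' hva.ne' hne ha' ha.le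
  have e1 : orient (Γ.pos v) (Γ.pos a') (Γ.pos a) = -orient (Γ.pos v) (Γ.pos a) (Γ.pos a') := by
    simp only [orient]; ring
  have e2 : orient (Γ.pos a') (Γ.pos u) (Γ.pos a) = -orient (Γ.pos a) (Γ.pos u) (Γ.pos a') := by
    simp only [orient]; ring
  have e3 : orient (Γ.pos a) (Γ.pos u) (Γ.pos v) = orient (Γ.pos u) (Γ.pos v) (Γ.pos a) := by
    simp only [orient]; ring
  have e4 : orient (Γ.pos v) (Γ.pos a') (Γ.pos u) = orient (Γ.pos u) (Γ.pos v) (Γ.pos a') := by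
    simp only [orient]; ring
  have e5 : orient (Γ.pos a') (Γ.pos u) (Γ.pos v) = orient (Γ.pos u) (Γ.pos v) (Γ.pos a') := by
    simp only [orient]; ring
  have e6 : orient (Γ.pos v) (Γ.pos a) (Γ.pos u) = orient (Γ.pos u) (Γ.pos v) (Γ.pos a) := by
    simp only [orient]; ring
  rw [e1, e2] at w2
  rcases lt_or_ge (orient (Γ.pos v) (Γ.pos a) (Γ.pos a')) 0 with c1 | c1 <;>
    rcases lt_or_ge (orient (Γ.pos a) (Γ.pos u) (Γ.pos a')) 0 with c2 | c2
  · exact Or.inr (w2 (by linarith) (by linarith))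
  · rcases c2.eq_or_lt with c2 | c2
    · exact Or.inr (w2 (by linarith) (by linarith))
    · refine absurd (exists_mem_segment_of_orient (p := Γ.pos a') (q := Γ.pos u) (r := Γ.pos v)
        (s := Γ.pos a) ?_ ?_ ?_ ?_)
        (h.disjoint_segment hua'.symm hva hva'.ne' hne.symm huv.ne hua.ne) <;> linarith
  · rcases c1.eq_or_lt with c1 | c1
    · exact Or.inr (w2 (by linarith) (by linarith))
    · refine absurd (exists_mem_segment_of_orient (p := Γ.pos a) (q := Γ.pos u) (r := Γ.pos v)
        (s := Γ.pos a') ?_ ?_ ?_ ?_)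
        (h.disjoint_segment hua.symm hva' hva.ne' hne huv.ne hua'.ne) <;> linarith
  · exact Or.inl (w1 c1 c2)

theorem IsPlanar.opposite_or_nested (h : Γ.IsPlanar) {u v a a' : V} (huv : G.Adj u v)
    (hua : G.Adj u a) (hva : G.Adj v a) (hua' : G.Adj u a') (hva' : G.Adj v a') (hne : a ≠ a') :
    orient (Γ.pos u) (Γ.pos v) (Γ.pos a) * orient (Γ.pos u) (Γ.pos v) (Γ.pos a') < 0 ∨
    InTri (Γ.pos u) (Γ.pos v) (Γ.pos a) (Γ.pos a') ∨
      InTri (Γ.pos u) (Γ.pos v) (Γ.pos a') (Γ.pos a) := by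
  rcases (h.orient_ne_zero huv hva hua.symm).lt_or_gt with c1 | c1 <;>
    rcases (h.orient_ne_zero huv hva' hua'.symm).lt_or_gt with c2 | c2
  · rw [← neg_pos, ← orient_swap] at c1 c2
    exact Or.inr ((h.nested_of_pos huv.symm hva hua hva' hua' hne c1 c2).imp (·.swap) (·.swap))
  · exact Or.inl (mul_neg_of_neg_of_pos c1 c2)
  · exact Or.inl (mul_neg_of_pos_of_neg c1 c2)
  · exact Or.inr (h.nested_of_pos huv hua hva hua' hva' hne c1 c2)

/-- In a drawing of `K₄` with `a`, `a'` on different sides of `uv`, one of `u`, `v` is enclosed. -/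
theorem IsPlanar.inTri_of_opposite (h : Γ.IsPlanar) {u v a a' : V} (huv : G.Adj u v)
    (hua : G.Adj u a) (hva : G.Adj v a) (hua' : G.Adj u a') (hva' : G.Adj v a')
    (haa' : G.Adj a a')
    (ho : orient (Γ.pos u) (Γ.pos v) (Γ.pos a) * orient (Γ.pos u) (Γ.pos v) (Γ.pos a') < 0) :
    InTri (Γ.pos v) (Γ.pos a) (Γ.pos a') (Γ.pos u) ∨
      InTri (Γ.pos u) (Γ.pos a) (Γ.pos a') (Γ.pos v) := by
  have main : ∀ a a' : V, G.Adj u a → G.Adj v a → G.Adj u a' → G.Adj v a' → G.Adj a a' →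
      0 < orient (Γ.pos u) (Γ.pos v) (Γ.pos a) → orient (Γ.pos u) (Γ.pos v) (Γ.pos a') < 0 →
      InTri (Γ.pos v) (Γ.pos a) (Γ.pos a') (Γ.pos u) ∨
      InTri (Γ.pos u) (Γ.pos a) (Γ.pos a') (Γ.pos v) := by
    intro a a' hua hva hua' hva' haa' c1 c2
    have e1 : orient (Γ.pos v) (Γ.pos a) (Γ.pos u) = orient (Γ.pos u) (Γ.pos v) (Γ.pos a) := by
      simp only [orient]; ring
    have e2 : orient (Γ.pos a') (Γ.pos v) (Γ.pos u) = -orient (Γ.pos u) (Γ.pos v) (Γ.pos a') := by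
      simp only [orient]; ring
    have e3 : orient (Γ.pos u) (Γ.pos a) (Γ.pos v) = -orient (Γ.pos u) (Γ.pos v) (Γ.pos a) := by
      simp only [orient]; ring
    have e4 : orient (Γ.pos a') (Γ.pos u) (Γ.pos v) = orient (Γ.pos u) (Γ.pos v) (Γ.pos a') := by
      simp only [orient]; ring
    unfold InTri
    rw [e1, e2, e3, e4]
    have n1 : orient (Γ.pos a) (Γ.pos a') (Γ.pos u) ≠ 0 :=
      h.orient_ne_zero haa' hua'.symm hua
    have n2 : orient (Γ.pos a) (Γ.pos a') (Γ.pos v) ≠ 0 :=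
      h.orient_ne_zero haa' hva'.symm hva
    rcases n1.lt_or_gt with c3 | c3
    · rcases n2.lt_or_gt with c4 | c4
      · exact Or.inr (Or.inr ⟨by linarith, c4, c2⟩)
      · exact absurd (exists_mem_segment_of_orient (p := Γ.pos u) (q := Γ.pos v) (r := Γ.pos a)
          (s := Γ.pos a') c1 c2 c4 c3) (h.disjoint_segment huv haa' hua.ne hua'.ne hva.ne hva'.ne)
    · exact Or.inl (Or.inl ⟨c1, c3, by linarith⟩)
  rcases mul_neg_iff.1 ho with ⟨c1, c2⟩ | ⟨c1, c2⟩
  · exact main a a' hua hva hua' hva' haa' c1 c2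
  · exact (main a' a hua' hva' hua hva haa'.symm c2 c1).imp (·.swap.rotate) (·.swap.rotate)

theorem IsPlanar.inTri_face_of_pos (h : Γ.IsPlanar) {u v a a' b : V} (huv : G.Adj u v)
    (hua : G.Adj u a) (hva : G.Adj v a) (hua' : G.Adj u a') (hva' : G.Adj v a')
    (haa' : G.Adj a a') (hbu : G.Adj b u) (hba : G.Adj b a) (hba' : G.Adj b a') (hbv : b ≠ v)
    (h1 : 0 < orient (Γ.pos u) (Γ.pos v) (Γ.pos a'))
    (h2 : 0 < orient (Γ.pos v) (Γ.pos a) (Γ.pos a'))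
    (h3 : 0 < orient (Γ.pos a) (Γ.pos u) (Γ.pos a')) :
    InTri (Γ.pos u) (Γ.pos a) (Γ.pos a') (Γ.pos b) := by
  have hsum := orient_add (Γ.pos u) (Γ.pos v) (Γ.pos a) (Γ.pos a')
  have rot : ∀ p q r : V, orient (Γ.pos q) (Γ.pos r) (Γ.pos p)
      = orient (Γ.pos p) (Γ.pos q) (Γ.pos r) := fun p q r => orient_rotate _ _ _
  have swp : ∀ p q r : V, orient (Γ.pos q) (Γ.pos p) (Γ.pos r)
      = -orient (Γ.pos p) (Γ.pos q) (Γ.pos r) := fun p q r => orient_swap _ _ _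
  have hb := h.inTri_of_adj huv hva hua.symm hba'.symm hua'.ne' hva'.ne' haa'.ne' hbu.ne hbv
    hba.ne (Or.inl ⟨h1, h2, h3⟩)
  obtain ⟨b1, b2, b3⟩ : 0 < orient (Γ.pos u) (Γ.pos v) (Γ.pos b) ∧
      0 < orient (Γ.pos v) (Γ.pos a) (Γ.pos b) ∧ 0 < orient (Γ.pos a) (Γ.pos u) (Γ.pos b) := by
    have := orient_add (Γ.pos u) (Γ.pos v) (Γ.pos a) (Γ.pos b)
    rcases hb with hb | hb
    · exact hb
    · linarith [hb.1, hb.2.1, hb.2.2]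
  have n1 : ¬ InTri (Γ.pos u) (Γ.pos v) (Γ.pos a') (Γ.pos b) := by
    intro hc
    have := h.inTri_of_adj huv hva' hua'.symm hba hbu.ne hbv hba'.ne hua.ne' hva.ne' haa'.ne hc
    have e := rot a v a'
    have e' := swp v a a'
    rcases this with t | t <;> linarith [t.1, t.2.1, t.2.2]
  have n2 : ¬ InTri (Γ.pos v) (Γ.pos a) (Γ.pos a') (Γ.pos b) := by
    intro hc
    have := h.inTri_of_adj hva haa' hva'.symm hbu hbv hba.ne hba'.ne huv.ne hua.ne hua'.ne hc
    have e := rot u v a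
    have e1 := rot a' v u
    have e2 := rot v u a'
    have e' := swp u v a'
    rcases this with t | t <;> linarith [t.1, t.2.1, t.2.2]
  by_contra n3
  have key : orient (Γ.pos v) (Γ.pos a) (Γ.pos a') * orient (Γ.pos a') (Γ.pos u) (Γ.pos b)
      + orient (Γ.pos a) (Γ.pos u) (Γ.pos a') * orient (Γ.pos a') (Γ.pos v) (Γ.pos b)
      + orient (Γ.pos u) (Γ.pos v) (Γ.pos a') * orient (Γ.pos a') (Γ.pos a) (Γ.pos b) = 0 := by
    simp only [orient]; ring
  have k1 : ¬ (orient (Γ.pos a') (Γ.pos v) (Γ.pos b) ≤ 0 ∧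
      0 ≤ orient (Γ.pos a') (Γ.pos u) (Γ.pos b)) := fun ⟨c1, c2⟩ =>
    n1 (h.pos_of_nonneg huv hva' hua'.symm hbu.ne hbv hba'.ne h1 b1.le
      (by rw [swp a' v]; linarith) c2)
  have k2 : ¬ (orient (Γ.pos a') (Γ.pos a) (Γ.pos b) ≤ 0 ∧
      0 ≤ orient (Γ.pos a') (Γ.pos v) (Γ.pos b)) := fun ⟨c1, c2⟩ =>
    n2 (h.pos_of_nonneg hva haa' hva'.symm hbv hba.ne hba'.ne h2 b2.le
      (by rw [swp a' a]; linarith) c2)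
  have k3 : ¬ (orient (Γ.pos a') (Γ.pos u) (Γ.pos b) ≤ 0 ∧
      0 ≤ orient (Γ.pos a') (Γ.pos a) (Γ.pos b)) := fun ⟨c1, c2⟩ =>
    n3 (h.pos_of_nonneg hua.symm hua' haa'.symm hba.ne hbu.ne hba'.ne h3 b3.le
      (by rw [swp a' u]; linarith) c2).swap
  push Not at k1 k2 k3
  rcases le_or_gt 0 (orient (Γ.pos a') (Γ.pos u) (Γ.pos b)) with c | c
  · have c1 : 0 < orient (Γ.pos a') (Γ.pos v) (Γ.pos b) := by
      by_contra! hc; linarith [k1 hc]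
    have c2 : 0 < orient (Γ.pos a') (Γ.pos a) (Γ.pos b) := by
      by_contra! hc; linarith [k2 hc]
    have := mul_nonneg h2.le c
    have := mul_pos h3 c1
    have := mul_pos h1 c2
    linarith
  · have c2 := k3 c.le
    have c1 := k2 c2.le
    have := mul_neg_of_pos_of_neg h2 c
    have := mul_neg_of_pos_of_neg h3 c1
    have := mul_neg_of_pos_of_neg h1 c2
    linarith

/-- In a drawing of `K₄` with `a'` enclosed, a further neighbour of `u`, `a`, `a'` lies in the
face bounded by them. -/
theorem IsPlanar.inTri_face (h : Γ.IsPlanar) {u v a a' b : V} (huv : G.Adj u v)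
    (hua : G.Adj u a) (hva : G.Adj v a) (hua' : G.Adj u a') (hva' : G.Adj v a')
    (haa' : G.Adj a a') (hbu : G.Adj b u) (hba : G.Adj b a) (hba' : G.Adj b a') (hbv : b ≠ v)
    (hin : InTri (Γ.pos u) (Γ.pos v) (Γ.pos a) (Γ.pos a')) :
    InTri (Γ.pos u) (Γ.pos a) (Γ.pos a') (Γ.pos b) := by
  rcases hin with ⟨h1, h2, h3⟩ | ⟨h1, h2, h3⟩
  · exact h.inTri_face_of_pos huv hua hva hua' hva' haa' hbu hba hba' hbv h1 h2 h3
  · rw [← neg_pos, ← orient_swap] at h1 h2 h3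
    exact (h.inTri_face_of_pos hva.symm hua.symm huv.symm haa' hva' hua' hba hbu hba' hbv
      h2 h1 h3).swap

end StraightDrawing

/-- The image of an integer point in the plane. -/
def toPt (p : ℤ × ℤ) : Pt := ((p.1 : ℝ), (p.2 : ℝ))

theorem orient_toPt (p q r : ℤ × ℤ) : orient (toPt p) (toPt q) (toPt r) = (orient p q r : ℤ) := by
  simp [orient, toPt]

theorem inTri_toPt {p q r x : ℤ × ℤ} :
    InTri (toPt p) (toPt q) (toPt r) (toPt x) ↔ InTri p q r x := by
  simp only [InTri, orient_toPt, Int.cast_pos, Int.cast_lt_zero]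

/-- The combinatorial facts about a planar grid drawing of `H_d` in the rows `1, …, h` which are
used for the lower bounds. -/
structure NestedConfig (d h : ℕ) (u v : ℤ × ℤ) (a b c : ℕ → ℤ × ℤ) : Prop where
  row_u : 1 ≤ u.2 ∧ u.2 ≤ h
  row_v : 1 ≤ v.2 ∧ v.2 ≤ h
  row_a : ∀ i, i < d → 1 ≤ (a i).2 ∧ (a i).2 ≤ h
  nested : ∀ i j, i < d → j < d → i ≠ j → orient u v (a i) * orient u v (a j) < 0 ∨
    InTri u v (a i) (a j) ∨ InTri u v (a j) (a i)
  separated : ∀ i k, i + 1 < d → k < d → k ≠ i → k ≠ i + 1 →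
    (InTri u v (a k) (a i) ↔ InTri u v (a k) (a (i + 1)))
  enclosed : ∀ i, i + 1 < d → orient u v (a i) * orient u v (a (i + 1)) < 0 →
    InTri v (a i) (a (i + 1)) u ∨ InTri u (a i) (a (i + 1)) v
  face_u : ∀ i, i + 1 < d → InTri u v (a i) (a (i + 1)) ∨ InTri u v (a (i + 1)) (a i) →
    InTri u (a i) (a (i + 1)) (b i)
  face_v : ∀ i, i + 1 < d → InTri u v (a i) (a (i + 1)) ∨ InTri u v (a (i + 1)) (a i) →
    InTri v (a i) (a (i + 1)) (c i)

theorem exists_nestedConfig {d h : ℕ} {Γ : StraightDrawing (Hgraph d)} (hΓ : Γ.IsPlanar)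
    (hg : Γ.IsGrid) (hh : Γ.HeightLe h) :
    ∃ (u v : ℤ × ℤ) (a b c : ℕ → ℤ × ℤ), NestedConfig d h u v a b c ∧
      Γ.pos .u = toPt u ∧ Γ.pos .v = toPt v ∧ ∀ i (hi : i < d), Γ.pos (.a ⟨i, hi⟩) = toPt (a i) := by
  choose P hP using hg
  have hP' : ∀ w, Γ.pos w = toPt (P w) := hP
  have rows : ∀ w, 1 ≤ (P w).2 ∧ (P w).2 ≤ h := by
    intro w
    obtain ⟨k, h1, h2, h3⟩ := hh w
    rw [hP] at h3
    simp only at h3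
    have : (P w).2 = k := by exact_mod_cast h3
    omega
  have uv : (Hgraph d).Adj .u .v := by simp [Hgraph, HRel]
  have ua : ∀ i, (Hgraph d).Adj .u (.a i) := by simp [Hgraph, HRel]
  have va : ∀ i, (Hgraph d).Adj .v (.a i) := by simp [Hgraph, HRel]
  have aa : ∀ i (hi : i + 1 < d),
      (Hgraph d).Adj (.a ⟨i, by omega⟩) (.a ⟨i + 1, hi⟩) := by simp [Hgraph, HRel]
  have bu : ∀ i, (Hgraph d).Adj (.b i) .u := by simp [Hgraph, HRel]
  have cv : ∀ i, (Hgraph d).Adj (.c i) .v := by simp [Hgraph, HRel]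
  have ba : ∀ i (hi : i + 1 < d),
      (Hgraph d).Adj (.b ⟨i, by omega⟩) (.a ⟨i, by omega⟩) := by simp [Hgraph, HRel]
  have ca : ∀ i (hi : i + 1 < d),
      (Hgraph d).Adj (.c ⟨i, by omega⟩) (.a ⟨i, by omega⟩) := by simp [Hgraph, HRel]
  have ba' : ∀ i (hi : i + 1 < d),
      (Hgraph d).Adj (.b ⟨i, by omega⟩) (.a ⟨i + 1, hi⟩) := by simp [Hgraph, HRel]
  have ca' : ∀ i (hi : i + 1 < d),
      (Hgraph d).Adj (.c ⟨i, by omega⟩) (.a ⟨i + 1, hi⟩) := by simp [Hgraph, HRel]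
  let A : ℕ → ℤ × ℤ := fun i => if hi : i < d then P (.a ⟨i, hi⟩) else 0
  let B : ℕ → ℤ × ℤ := fun i => if hi : i < d - 1 then P (.b ⟨i, hi⟩) else 0
  let C : ℕ → ℤ × ℤ := fun i => if hi : i < d - 1 then P (.c ⟨i, hi⟩) else 0
  have hA : ∀ i (hi : i < d), A i = P (.a ⟨i, hi⟩) := fun i hi => dif_pos hi
  have hB : ∀ i (hi : i < d - 1), B i = P (.b ⟨i, hi⟩) := fun i hi => dif_pos hi
  have hC : ∀ i (hi : i < d - 1), C i = P (.c ⟨i, hi⟩) := fun i hi => dif_pos hi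
  refine ⟨P .u, P .v, A, B, C, ⟨rows _, rows _, ?_, ?_, ?_, ?_, ?_, ?_⟩, hP' _, hP' _, ?_⟩
  · intro i hi
    rw [hA i hi]; exact rows _
  · intro i j hi hj hij
    have := hΓ.opposite_or_nested uv (ua ⟨i, hi⟩) (va ⟨i, hi⟩) (ua ⟨j, hj⟩) (va ⟨j, hj⟩)
      (by simpa using hij)
    simp only [hP', inTri_toPt, orient_toPt] at this
    rw [hA i hi, hA j hj]
    exact_mod_cast this
  · intro i k hi hk h1 h2
    rw [hA i (by omega), hA (i + 1) hi, hA k hk]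
    simp only [← inTri_toPt, ← hP']
    constructor
    · exact hΓ.inTri_of_adj uv (va ⟨k, hk⟩) (ua ⟨k, hk⟩).symm (aa i hi) (by simp) (by simp)
        (by simpa using Ne.symm h1) (by simp) (by simp) (by simpa using Ne.symm h2)
    · exact hΓ.inTri_of_adj uv (va ⟨k, hk⟩) (ua ⟨k, hk⟩).symm (aa i hi).symm (by simp) (by simp)
        (by simpa using Ne.symm h2) (by simp) (by simp) (by simpa using Ne.symm h1)
  · intro i hi ho
    rw [hA i (by omega), hA (i + 1) hi] at *
    have := hΓ.inTri_of_opposite uv (ua _) (va _) (ua _) (va _) (aa i hi)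
    simp only [hP', inTri_toPt, orient_toPt] at this
    exact this (by exact_mod_cast ho)
  · intro i hi ho
    rw [hA i (by omega), hA (i + 1) hi, hB i (by omega)] at *
    simp only [← inTri_toPt, ← hP'] at *
    rcases ho with ho | ho
    · exact hΓ.inTri_face uv (ua _) (va _) (ua _) (va _) (aa i hi) (bu _) (ba i hi) (ba' i hi)
        (by simp) ho
    · exact (hΓ.inTri_face uv (ua _) (va _) (ua _) (va _) (aa i hi).symm (bu _) (ba' i hi)
        (ba i hi) (by simp) ho).swap.rotate
  · intro i hi ho
    rw [hA i (by omega), hA (i + 1) hi, hC i (by omega)] at *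
    simp only [← inTri_toPt, ← hP'] at *
    rcases ho with ho | ho
    · exact hΓ.inTri_face uv.symm (va _) (ua _) (va _) (ua _) (aa i hi) (cv _) (ca i hi)
        (ca' i hi) (by simp) ho.swap
    · exact (hΓ.inTri_face uv.symm (va _) (ua _) (va _) (ua _) (aa i hi).symm (cv _) (ca' i hi)
        (ca i hi) (by simp) ho.swap).swap.rotate
  · intro i hi
    rw [hA i hi]; exact hP' _

theorem InTri.mul_orient_pos {u v p q : ℤ × ℤ} (h : InTri u v p q) :
    0 < orient u v p * orient u v q := by
  have hs := orient_add u v p q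
  rcases h with ⟨h1, h2, h3⟩ | ⟨h1, h2, h3⟩
  · exact mul_pos (by linarith) h1
  · exact mul_pos_of_neg_of_neg (by linarith) h1

theorem InTri.asymm {u v p q : ℤ × ℤ} (h : InTri u v p q) : ¬ InTri u v q p := by
  intro h'
  have hs := orient_add u v p q
  have hs' := orient_add u v q p
  rcases h with ⟨h1, h2, h3⟩ | ⟨h1, h2, h3⟩ <;> rcases h' with ⟨g1, g2, g3⟩ | ⟨g1, g2, g3⟩ <;>
    linarith

/-- Two points are on the same side of a line if both are on the same side as a third one. -/
theorem mul_pos_of_common {x y z : ℤ} (h1 : 0 < y * x) (h2 : 0 < y * z) : 0 < x * z := by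
  rcases mul_pos_iff.1 h1 with ⟨a, b⟩ | ⟨a, b⟩ <;> rcases mul_pos_iff.1 h2 with ⟨a', c⟩ | ⟨a', c⟩
  · exact mul_pos b c
  · omega
  · omega
  · exact mul_pos_of_neg_of_neg b c

/-- The constraints on the rows of `u`, `v`, `p`, `q` when `q` is inside the triangle `u v p` and
the triangles `u p q` and `v p q` contain grid points. -/
def RowStep (u v p q : ℤ) : Prop :=
  (q < u ∨ q < v ∨ q < p) ∧ (u < q ∨ v < q ∨ p < q) ∧
    (2 ≤ |p - u| ∨ 2 ≤ |p - q| ∨ 2 ≤ |q - u|) ∧ (2 ≤ |p - v| ∨ 2 ≤ |p - q| ∨ 2 ≤ |q - v|)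

instance RowStep.decidable (u v p q : ℤ) : Decidable (RowStep u v p q) := by
  unfold RowStep
  infer_instance

theorem rowStep_of_inTri {u v p q b c : ℤ × ℤ} (hq : InTri u v p q) (hb : InTri u p q b)
    (hc : InTri v p q c) : RowStep u.2 v.2 p.2 q.2 := by
  have b1 := hb.snd_lt
  have b2 := hb.lt_snd
  have c1 := hc.snd_lt
  have c2 := hc.lt_snd
  refine ⟨hq.snd_lt, hq.lt_snd, ?_, ?_⟩ <;> simp only [le_abs] <;> omega

theorem ends_of_rowStep : ∀ u ∈ Finset.Icc (1 : ℤ) 4, ∀ v ∈ Finset.Icc (1 : ℤ) 4,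
    ¬ (u = 1 ∧ v = 4 ∨ u = 4 ∧ v = 1) → ∀ p ∈ Finset.Icc (1 : ℤ) 4, ∀ q ∈ Finset.Icc (1 : ℤ) 4,
    RowStep u v p q → ∀ r ∈ Finset.Icc (1 : ℤ) 4, RowStep u v q r →
    ∀ s ∈ Finset.Icc (1 : ℤ) 4, ¬ RowStep u v r s := by
  decide +kernel

/-- Four nested triangles over `uv` with grid points in all faces need `u`, `v` in the rows
`1` and `4`. -/
theorem rows_of_four_nested {u v p q r s b₁ b₂ b₃ c₁ c₂ c₃ : ℤ × ℤ}
    (hu : 1 ≤ u.2 ∧ u.2 ≤ 4) (hv : 1 ≤ v.2 ∧ v.2 ≤ 4) (hp : 1 ≤ p.2 ∧ p.2 ≤ 4)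
    (hq : InTri u v p q) (hr : InTri u v q r) (hs : InTri u v r s)
    (hb₁ : InTri u p q b₁) (hb₂ : InTri u q r b₂) (hb₃ : InTri u r s b₃)
    (hc₁ : InTri v p q c₁) (hc₂ : InTri v q r c₂) (hc₃ : InTri v r s c₃) :
    u.2 = 1 ∧ v.2 = 4 ∨ u.2 = 4 ∧ v.2 = 1 := by
  have bound : ∀ {p q : ℤ × ℤ}, InTri u v p q → 1 ≤ p.2 ∧ p.2 ≤ 4 → 1 ≤ q.2 ∧ q.2 ≤ 4 := by
    intro p q h hp
    have h1 := h.snd_lt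
    have h2 := h.lt_snd
    omega
  have hq' := bound hq hp
  have hr' := bound hr hq'
  have hs' := bound hs hr'
  by_contra hne
  exact ends_of_rowStep _ (Finset.mem_Icc.2 hu) _ (Finset.mem_Icc.2 hv) hne _
    (Finset.mem_Icc.2 hp) _ (Finset.mem_Icc.2 hq') (rowStep_of_inTri hq hb₁ hc₁) _
    (Finset.mem_Icc.2 hr') (rowStep_of_inTri hr hb₂ hc₂) _ (Finset.mem_Icc.2 hs')
    (rowStep_of_inTri hs hb₃ hc₃)

namespace NestedConfig

variable {d h : ℕ} {u v : ℤ × ℤ} {a b c : ℕ → ℤ × ℤ}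

/-- Exactly one of the two neighbours of an interior path vertex is inside its triangle. -/
theorem inTri_pred_iff (H : NestedConfig d h u v a b c) {k : ℕ} (hk : k + 2 < d) :
    InTri u v (a (k + 1)) (a k) ↔ ¬ InTri u v (a (k + 1)) (a (k + 2)) := by
  have s0 : InTri u v (a k) (a (k + 1)) ↔ InTri u v (a k) (a (k + 2)) :=
    H.separated (k + 1) k (by omega) (by omega) (by omega) (by omega)
  have s2 := H.separated k (k + 2) (by omega) (by omega) (by omega) (by omega)
  have n01 := H.nested k (k + 1) (by omega) (by omega) (by omega)
  have n12 := H.nested (k + 1) (k + 2) (by omega) (by omega) (by omega)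
  have n02 := H.nested k (k + 2) (by omega) (by omega) (by omega)
  have comm := mul_comm (orient u v (a k)) (orient u v (a (k + 1)))
  constructor
  · intro h1 h2
    rcases n02 with n | n | n
    · have := mul_pos_of_common h1.mul_orient_pos h2.mul_orient_pos
      omega
    · exact h1.asymm (s0.2 n)
    · exact h2.asymm (s2.1 n)
  · intro h1
    by_contra h2
    have m01 : orient u v (a k) * orient u v (a (k + 1)) < 0 ∨ InTri u v (a k) (a (k + 1)) := by
      tauto
    have m12 : orient u v (a (k + 1)) * orient u v (a (k + 2)) < 0 ∨
      InTri u v (a (k + 2)) (a (k + 1)) := by tauto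
    rcases m01 with m | m
    · have no : ¬ InTri u v (a k) (a (k + 1)) := fun t => by
        have := t.mul_orient_pos
        omega
      rcases m12 with m' | m'
      · rcases n02 with n | n | n
        · have := mul_pos_of_common (x := -orient u v (a k)) (y := orient u v (a (k + 1)))
            (z := -orient u v (a (k + 2))) (by linarith) (by linarith)
          linarith
        · exact no (s0.2 n)
        · have := (s2.1 n).mul_orient_pos
          have := mul_comm (orient u v (a (k + 1))) (orient u v (a (k + 2)))
          omega
      · have := mul_pos_of_common m'.mul_orient_pos (s2.2 m').mul_orient_pos
        omega
    · rcases m12 with m' | m'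
      · have := mul_pos_of_common m.mul_orient_pos (s0.1 m).mul_orient_pos
        omega
      · exact (s0.1 m).asymm (s2.2 m')

theorem rows_of_inner (H : NestedConfig d 4 u v a b c) {k : ℕ} (hk : k + 3 < d)
    (h0 : InTri u v (a k) (a (k + 1))) (h1 : InTri u v (a (k + 1)) (a (k + 2)))
    (h2 : InTri u v (a (k + 2)) (a (k + 3))) : u.2 = 1 ∧ v.2 = 4 ∨ u.2 = 4 ∧ v.2 = 1 :=
  rows_of_four_nested H.row_u H.row_v (H.row_a k (by omega)) h0 h1 h2
    (H.face_u k (by omega) (Or.inl h0)) (H.face_u (k + 1) (by omega) (Or.inl h1))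
    (H.face_u (k + 2) (by omega) (Or.inl h2))
    (H.face_v k (by omega) (Or.inl h0)) (H.face_v (k + 1) (by omega) (Or.inl h1))
    (H.face_v (k + 2) (by omega) (Or.inl h2))

theorem rows_of_outer (H : NestedConfig d 4 u v a b c) {k : ℕ} (hk : k + 3 < d)
    (h0 : InTri u v (a (k + 1)) (a k)) (h1 : InTri u v (a (k + 2)) (a (k + 1)))
    (h2 : InTri u v (a (k + 3)) (a (k + 2))) : u.2 = 1 ∧ v.2 = 4 ∨ u.2 = 4 ∧ v.2 = 1 :=
  rows_of_four_nested H.row_u H.row_v (H.row_a (k + 3) (by omega)) h2 h1 h0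
    (H.face_u (k + 2) (by omega) (Or.inr h2)).swap.rotate
    (H.face_u (k + 1) (by omega) (Or.inr h1)).swap.rotate
    (H.face_u k (by omega) (Or.inr h0)).swap.rotate
    (H.face_v (k + 2) (by omega) (Or.inr h2)).swap.rotate
    (H.face_v (k + 1) (by omega) (Or.inr h1)).swap.rotate
    (H.face_v k (by omega) (Or.inr h0)).swap.rotate

theorem inTri_succ (H : NestedConfig d h u v a b c) {k : ℕ} (hk : k + 2 < d)
    (hn : ¬ InTri u v (a (k + 1)) (a k)) : InTri u v (a (k + 1)) (a (k + 2)) := by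
  by_contra h
  exact hn ((H.inTri_pred_iff hk).2 h)

theorem inTri_pred (H : NestedConfig d h u v a b c) {k : ℕ} (hk : k + 2 < d)
    (hn : InTri u v (a (k + 2)) (a (k + 1))) : InTri u v (a (k + 1)) (a k) :=
  (H.inTri_pred_iff hk).2 hn.asymm

theorem rows_eq (H : NestedConfig d 4 u v a b c) (hd : 11 ≤ d) :
    u.2 = 1 ∧ v.2 = 4 ∨ u.2 = 4 ∧ v.2 = 1 := by
  by_cases h5 : InTri u v (a 6) (a 5)
  · have h4 := H.inTri_pred (k := 4) (by omega) h5
    have h3 := H.inTri_pred (k := 3) (by omega) h4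
    exact H.rows_of_outer (k := 3) (by omega) h3 h4 h5
  · have h6 := H.inTri_succ (k := 5) (by omega) h5
    have h7 := H.inTri_succ (k := 6) (by omega) h6.asymm
    have h8 := H.inTri_succ (k := 7) (by omega) h7.asymm
    exact H.rows_of_inner (k := 6) (by omega) h6 h7 h8

theorem mono_height (H : NestedConfig d h u v a b c) {h' : ℕ} (hh : h ≤ h') :
    NestedConfig d h' u v a b c where
  row_u := ⟨H.row_u.1, H.row_u.2.trans (by exact_mod_cast hh)⟩
  row_v := ⟨H.row_v.1, H.row_v.2.trans (by exact_mod_cast hh)⟩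
  row_a i hi := ⟨(H.row_a i hi).1, (H.row_a i hi).2.trans (by exact_mod_cast hh)⟩
  nested := H.nested
  separated := H.separated
  enclosed := H.enclosed
  face_u := H.face_u
  face_v := H.face_v

theorem inTri_or_inTri (H : NestedConfig d 4 u v a b c) (hd : 11 ≤ d) {k : ℕ} (hk : k + 1 < d) :
    InTri u v (a k) (a (k + 1)) ∨ InTri u v (a (k + 1)) (a k) := by
  rcases H.nested k (k + 1) (by omega) hk (by omega) with n | n
  · have hr := H.rows_eq hd
    have r1 := H.row_a k (by omega)
    have r2 := H.row_a (k + 1) (by omega)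
    rcases H.enclosed k hk n with e | e
    · have e1 := e.snd_lt
      have e2 := e.lt_snd
      omega
    · have e1 := e.snd_lt
      have e2 := e.lt_snd
      omega
  · exact n

theorem monotone_nested (H : NestedConfig d 4 u v a b c) (hd : 11 ≤ d) :
    (∀ k, k + 1 < d → InTri u v (a k) (a (k + 1))) ∨
      ∀ k, k + 1 < d → InTri u v (a (k + 1)) (a k) := by
  rcases H.inTri_or_inTri hd (k := 0) (by omega) with h0 | h0
  · left
    intro k hk
    induction k with
    | zero => exact h0
    | succ k ih => exact H.inTri_succ hk (ih (by omega)).asymm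
  · right
    intro k hk
    induction k with
    | zero => exact h0
    | succ k ih =>
      rcases H.inTri_or_inTri hd hk with g | g
      · exact absurd g ((H.inTri_pred_iff hk).1 (ih (by omega)))
      · exact g

end NestedConfig

theorem two_mul_abs_orient_le {u v p q b c : ℤ × ℤ} (hu : u.2 = 1) (hv : v.2 = 4)
    (hp : p.2 = 2 ∨ p.2 = 3) (hq : q.2 = 2 ∨ q.2 = 3) (h : InTri u v p q)
    (hb : InTri u p q b) (hc : InTri v p q c) :
    2 * |orient u v q| + 7 ≤ |orient u v p| := by
  have b1 := hb.snd_lt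
  have b2 := hb.lt_snd
  have c1 := hc.snd_lt
  have c2 := hc.lt_snd
  have hpq : p.2 = 2 ∧ q.2 = 3 ∨ p.2 = 3 ∧ q.2 = 2 := by omega
  clear hp hq
  rcases hpq with ⟨hp, hq⟩ | ⟨hp, hq⟩
  · have hc2 : c.2 = 3 := by omega
    clear b1 b2 c1 c2 hb
    simp only [InTri, orient, hu, hv, hp, hq, hc2] at *
    rcases h with h | h
    · rw [abs_of_pos h.1, abs_of_pos (by omega)]
      omega
    · rw [abs_of_neg h.1, abs_of_neg (by omega)]
      omega
  · have hb2 : b.2 = 2 := by omega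
    clear b1 b2 c1 c2 hc
    simp only [InTri, orient, hu, hv, hp, hq, hb2] at *
    rcases h with h | h
    · rw [abs_of_pos h.1, abs_of_pos (by omega)]
      omega
    · rw [abs_of_neg h.1, abs_of_neg (by omega)]
      omega

theorem exists_two_pow_le_of_rows {n : ℕ} (hn : 1 ≤ n) {u v : ℤ × ℤ} {a b c : ℕ → ℤ × ℤ}
    (hu : u.2 = 1) (hv : v.2 = 4) (ha : 1 ≤ (a 0).2 ∧ (a 0).2 ≤ 4)
    (h : ∀ i < n, InTri u v (a i) (a (i + 1)))
    (hb : ∀ i < n, InTri u (a i) (a (i + 1)) (b i))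
    (hc : ∀ i < n, InTri v (a i) (a (i + 1)) (c i)) :
    ∃ s t : ℤ × ℤ, (s = u ∨ s = v ∨ s = a 1) ∧ (t = u ∨ t = v ∨ t = a 1) ∧
      2 ^ (n + 2) ≤ 3 * (s.1 - t.1) + 7 := by
  have rows : ∀ i, i < n → (a (i + 1)).2 = 2 ∨ (a (i + 1)).2 = 3 := by
    intro i
    induction i with
    | zero =>
      intro hi
      have h1 := (h 0 hi).snd_lt
      have h2 := (h 0 hi).lt_snd
      omega
    | succ i ih =>
      intro hi
      have h0 := ih (by omega)
      have h1 := (h (i + 1) hi).snd_lt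
      have h2 := (h (i + 1) hi).lt_snd
      omega
  have grow : ∀ j, j < n → 8 * 2 ^ j ≤ |orient u v (a (n - j))| + 7 := by
    intro j
    induction j with
    | zero =>
      intro hj
      have h1 := (h (n - 1) (by omega)).mul_orient_pos
      rw [Nat.sub_add_cancel hn] at h1
      have : 0 < |orient u v (a n)| := abs_pos.2 (right_ne_zero_of_mul h1.ne')
      simpa using by omega
    | succ j ih =>
      intro hj
      have h0 := ih (by omega)
      obtain ⟨i, hi⟩ : ∃ i, n - (j + 1) = i + 1 := ⟨n - (j + 1) - 1, by omega⟩
      have hi' : n - j = i + 1 + 1 := by omega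
      rw [hi'] at h0
      rw [hi, pow_succ]
      have := two_mul_abs_orient_le hu hv (rows i (by omega)) (rows (i + 1) (by omega))
        (h (i + 1) (by omega)) (hb (i + 1) (by omega)) (hc (i + 1) (by omega))
      linarith
  have g := grow (n - 1) (by omega)
  have e : n - (n - 1) = 1 := by omega
  have e2 : (8 : ℤ) * 2 ^ (n - 1) = 2 ^ (n + 2) := by
    obtain ⟨m, rfl⟩ : ∃ m, n = m + 1 := ⟨n - 1, by omega⟩
    simp only [Nat.add_sub_cancel]; ring
  rw [e, e2] at g
  generalize (2 : ℤ) ^ (n + 2) = N at *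
  have key : N ≤ 3 * (u.1 - (a 1).1) + 7 ∨ N ≤ 3 * ((a 1).1 - u.1) + 7 ∨
      N ≤ 3 * (v.1 - (a 1).1) + 7 ∨ N ≤ 3 * ((a 1).1 - v.1) + 7 := by
    simp only [orient, hu, hv] at g
    rcases rows 0 (by omega) with r | r <;> simp only [zero_add] at r <;> rw [r] at g <;>
      rcases abs_cases ((v.1 - u.1) * (_ - 1) - (4 - 1) * ((a 1).1 - u.1)) with ⟨q, -⟩ | ⟨q, -⟩ <;>
      rw [q] at g <;> omega
  rcases key with k | k | k | k
  · exact ⟨u, a 1, by simp, by simp, k⟩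
  · exact ⟨a 1, u, by simp, by simp, k⟩
  · exact ⟨v, a 1, by simp, by simp, k⟩
  · exact ⟨a 1, v, by simp, by simp, k⟩

theorem exists_two_pow_le {n : ℕ} (hn : 1 ≤ n) {u v : ℤ × ℤ} {a b c : ℕ → ℤ × ℤ}
    (huv : u.2 = 1 ∧ v.2 = 4 ∨ u.2 = 4 ∧ v.2 = 1) (ha : 1 ≤ (a 0).2 ∧ (a 0).2 ≤ 4)
    (h : ∀ i < n, InTri u v (a i) (a (i + 1)))
    (hb : ∀ i < n, InTri u (a i) (a (i + 1)) (b i))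
    (hc : ∀ i < n, InTri v (a i) (a (i + 1)) (c i)) :
    ∃ s t : ℤ × ℤ, (s = u ∨ s = v ∨ s = a 1) ∧ (t = u ∨ t = v ∨ t = a 1) ∧
      2 ^ (n + 2) ≤ 3 * (s.1 - t.1) + 7 := by
  rcases huv with ⟨hu, hv⟩ | ⟨hu, hv⟩
  · exact exists_two_pow_le_of_rows hn hu hv ha h hb hc
  · obtain ⟨s, t, hs, ht, hst⟩ := exists_two_pow_le_of_rows hn hv hu ha
      (fun i hi => (h i hi).swap) hc hb
    exact ⟨s, t, by tauto, by tauto, hst⟩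

theorem NestedConfig.exists_wide {d : ℕ} {u v : ℤ × ℤ} {a b c : ℕ → ℤ × ℤ}
    (H : NestedConfig d 4 u v a b c) (hd : 11 ≤ d) :
    ∃ s t : ℤ × ℤ, (s = u ∨ s = v ∨ ∃ i < d, s = a i) ∧ (t = u ∨ t = v ∨ ∃ i < d, t = a i) ∧
      2 ^ (d + 1) ≤ 3 * (s.1 - t.1) + 7 := by
  obtain ⟨n, rfl⟩ : ∃ n, d = n + 1 := ⟨d - 1, by omega⟩
  rcases H.monotone_nested hd with m | m
  · obtain ⟨s, t, hs, ht, hst⟩ := exists_two_pow_le (n := n) (by omega) (H.rows_eq hd)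
      (H.row_a 0 (by omega)) (fun i hi => m i (by omega))
      (fun i hi => H.face_u i (by omega) (Or.inl (m i (by omega))))
      (fun i hi => H.face_v i (by omega) (Or.inl (m i (by omega))))
    exact ⟨s, t, hs.imp_right (Or.imp_right fun e => ⟨1, by omega, e⟩),
      ht.imp_right (Or.imp_right fun e => ⟨1, by omega, e⟩), hst⟩
  · have sub : ∀ i < n, n - i = n - 1 - i + 1 ∧ n - (i + 1) = n - 1 - i := by omega
    obtain ⟨s, t, hs, ht, hst⟩ := exists_two_pow_le (n := n) (a := fun i => a (n - i))
      (b := fun i => b (n - 1 - i)) (c := fun i => c (n - 1 - i)) (by omega) (H.rows_eq hd)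
      (H.row_a n (by omega))
      (fun i hi => by
        simp only [sub i hi]
        exact m (n - 1 - i) (by omega))
      (fun i hi => by
        simp only [sub i hi]
        exact (H.face_u (n - 1 - i) (by omega) (Or.inr (m _ (by omega)))).swap.rotate)
      (fun i hi => by
        simp only [sub i hi]
        exact (H.face_v (n - 1 - i) (by omega) (Or.inr (m _ (by omega)))).swap.rotate)
    exact ⟨s, t, hs.imp_right (Or.imp_right fun e => ⟨n - 1, by omega, e⟩),
      ht.imp_right (Or.imp_right fun e => ⟨n - 1, by omega, e⟩), hst⟩

theorem not_heightLe_three {d : ℕ} (hd : 11 ≤ d) :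
    ¬ ∃ Γ : StraightDrawing (Hgraph d), Γ.IsPlanar ∧ Γ.IsGrid ∧ Γ.HeightLe 3 := by
  rintro ⟨Γ, hp, hg, hh⟩
  obtain ⟨u, v, a, b, c, H, -⟩ := exists_nestedConfig hp hg hh
  have := (H.mono_height (h' := 4) (by norm_num)).rows_eq hd
  have := H.row_u
  have := H.row_v
  norm_cast at *
  omega

theorem exists_exponential_width {d : ℕ} (hd : 11 ≤ d) {Γ : StraightDrawing (Hgraph d)}
    (hp : Γ.IsPlanar) (hg : Γ.IsGrid) (hh : Γ.HeightLe 4) :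
    ∃ w₁ w₂ : HVert d, (4 / 3 : ℝ) * 2 ^ d ≤ ((Γ.pos w₁).1 - (Γ.pos w₂).1 + 1) * 4 := by
  obtain ⟨u, v, a, b, c, H, hu, hv, ha⟩ := exists_nestedConfig hp hg hh
  obtain ⟨s, t, hs, ht, hst⟩ := H.exists_wide hd
  have vert : ∀ s : ℤ × ℤ, (s = u ∨ s = v ∨ ∃ i < d, s = a i) → ∃ w, Γ.pos w = toPt s := by
    rintro s (rfl | rfl | ⟨i, hi, rfl⟩)
    · exact ⟨_, hu⟩
    · exact ⟨_, hv⟩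
    · exact ⟨_, ha i hi⟩
  obtain ⟨w₁, h₁⟩ := vert s hs
  obtain ⟨w₂, h₂⟩ := vert t ht
  refine ⟨w₁, w₂, ?_⟩
  rw [h₁, h₂]
  have hR : (2 : ℝ) ^ (d + 1) ≤ 3 * ((s.1 : ℝ) - t.1) + 7 := by exact_mod_cast hst
  have h8 : (2 : ℝ) ^ 3 ≤ 2 ^ d := pow_le_pow_right₀ (by norm_num) (by omega)
  rw [pow_succ] at hR
  simp only [toPt]
  linarith

/-- If the segment `pq` lies strictly on one side of the line `AB` except possibly for `p`, and the
segment `rs` lies weakly on the other side, then the segments can only meet in `p`. -/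
theorem eq_of_separated (A B : ℤ × ℤ) {p q r s : ℤ × ℤ} {z : Pt} (hp : 0 ≤ orient A B p)
    (hq : 0 < orient A B q) (hr : orient A B r ≤ 0) (hs : orient A B s ≤ 0)
    (hz : z ∈ segment ℝ (toPt p) (toPt q)) (hz' : z ∈ segment ℝ (toPt r) (toPt s)) :
    z = toPt p ∧ orient A B p = 0 := by
  obtain ⟨t, t0, t1, e1, e2⟩ := mem_segment_iff_exists.1 hz
  obtain ⟨t', t0', t1', e1', e2'⟩ := mem_segment_iff_exists.1 hz'
  have hp' : 0 ≤ orient (toPt A) (toPt B) (toPt p) := by rw [orient_toPt]; exact_mod_cast hp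
  have hq' : 0 < orient (toPt A) (toPt B) (toPt q) := by rw [orient_toPt]; exact_mod_cast hq
  have hr' : orient (toPt A) (toPt B) (toPt r) ≤ 0 := by rw [orient_toPt]; exact_mod_cast hr
  have hs' : orient (toPt A) (toPt B) (toPt s) ≤ 0 := by rw [orient_toPt]; exact_mod_cast hs
  have h1 : orient (toPt A) (toPt B) z = (1 - t) * orient (toPt A) (toPt B) (toPt p)
      + t * orient (toPt A) (toPt B) (toPt q) := by
    simp only [orient, e1, e2]; ring
  have h2 : orient (toPt A) (toPt B) z = (1 - t') * orient (toPt A) (toPt B) (toPt r)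
      + t' * orient (toPt A) (toPt B) (toPt s) := by
    simp only [orient, e1', e2']; ring
  have h3 := mul_nonneg (sub_nonneg.2 t1) hp'
  have h4 := mul_nonneg t0 hq'.le
  have h5 := mul_nonpos_of_nonneg_of_nonpos (sub_nonneg.2 t1') hr'
  have h6 := mul_nonpos_of_nonneg_of_nonpos t0' hs'
  have h7 : t = 0 := by
    rcases mul_eq_zero.1 (show t * orient (toPt A) (toPt B) (toPt q) = 0 by linarith) with h | h
    · exact h
    · exact absurd h hq'.ne'
  subst h7
  refine ⟨Prod.ext (by simpa using e1) (by simpa using e2), ?_⟩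
  have h8 : orient (toPt A) (toPt B) (toPt p) = 0 := by linarith
  rw [orient_toPt] at h8
  exact_mod_cast h8

/-- A point of a segment maximizing a linear functional uniquely among the ends is an end. -/
theorem eq_or_eq_of_extreme (α β : ℤ) {p r s : ℤ × ℤ}
    (hr : α * r.1 + β * r.2 < α * p.1 + β * p.2 ∨ p = r)
    (hs : α * s.1 + β * s.2 < α * p.1 + β * p.2 ∨ p = s)
    (hp : toPt p ∈ segment ℝ (toPt r) (toPt s)) : p = r ∨ p = s := by
  by_contra! hne
  have hr' := hr.resolve_right hne.1
  have hs' := hs.resolve_right hne.2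
  obtain ⟨t, t0, t1, e1, e2⟩ := mem_segment_iff_exists.1 hp
  simp only [toPt] at e1 e2
  have hr2 : (α : ℝ) * r.1 + β * r.2 < α * p.1 + β * p.2 := by exact_mod_cast hr'
  have hs2 : (α : ℝ) * s.1 + β * s.2 < α * p.1 + β * p.2 := by exact_mod_cast hs'
  have h : (α : ℝ) * p.1 + β * p.2 = (1 - t) * (α * r.1 + β * r.2) + t * (α * s.1 + β * s.2) := by
    rw [e1, e2]; ring
  rcases t0.eq_or_lt with rfl | t0
  · linarith
  · nlinarith

/-- The segments placed by `P` for two edges meet at most in the image of a common endpoint. -/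
structure MeetProperly {V : Type} (P : V → ℤ × ℤ) (e f : V × V) : Prop where
  exists_common : ∀ z ∈ segment ℝ (toPt (P e.1)) (toPt (P e.2)),
    z ∈ segment ℝ (toPt (P f.1)) (toPt (P f.2)) →
      ∃ w, (w = e.1 ∨ w = e.2) ∧ (w = f.1 ∨ w = f.2) ∧ z = toPt (P w)

namespace MeetProperly

variable {V : Type} {P : V → ℤ × ℤ} {p q r s : V} {e f : V × V}

theorem symm (h : MeetProperly P e f) : MeetProperly P f e where
  exists_common z hz hz' :=
    let ⟨w, h1, h2, h3⟩ := h.exists_common z hz' hz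
    ⟨w, h2, h1, h3⟩

theorem swap_left (h : MeetProperly P (p, q) f) : MeetProperly P (q, p) f where
  exists_common z hz hz' :=
    let ⟨w, h1, h2, h3⟩ := h.exists_common z (by rwa [segment_symm]) hz'
    ⟨w, h1.symm, h2, h3⟩

theorem swap_right (h : MeetProperly P e (r, s)) : MeetProperly P e (s, r) :=
  h.symm.swap_left.symm

theorem of_common (h : orient (P p) (P q) (P s) ≠ 0) : MeetProperly P (p, q) (p, s) := by
  refine ⟨fun z hz hz' => ⟨p, Or.inl rfl, Or.inl rfl, ?_⟩⟩
  have e1 : orient (P p) (P s) (P p) = 0 := by simp only [orient]; ring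
  have e2 : orient (P p) (P s) (P s) = 0 := by simp only [orient]; ring
  have e3 : orient (P p) (P s) (P q) = -orient (P p) (P q) (P s) := by simp only [orient]; ring
  rcases h.lt_or_gt with h | h
  · exact (eq_of_separated (P p) (P s) (p := P p) (q := P q) e1.ge (by omega) e1.le e2.le hz hz').1
  · have f := orient_swap (P p) (P s)
    refine (eq_of_separated (P s) (P p) (p := P p) (q := P q) (r := P p) (s := P s)
      ?_ ?_ ?_ ?_ hz hz').1 <;> rw [f] <;> omega

theorem of_sameSide (h : 0 < orient (P r) (P s) (P p) ∧ 0 < orient (P r) (P s) (P q) ∨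
    orient (P r) (P s) (P p) < 0 ∧ orient (P r) (P s) (P q) < 0) :
    MeetProperly P (p, q) (r, s) := by
  refine ⟨fun z hz hz' => False.elim ?_⟩
  have e1 : orient (P r) (P s) (P r) = 0 := by simp only [orient]; ring
  have e2 : orient (P r) (P s) (P s) = 0 := by simp only [orient]; ring
  rcases h with ⟨h1, h2⟩ | ⟨h1, h2⟩
  · exact h1.ne' (eq_of_separated (P r) (P s) h1.le h2 e1.le e2.le hz hz').2
  · have f := orient_swap (P r) (P s)
    have := (eq_of_separated (P s) (P r) (p := P p) (q := P q) (r := P r) (s := P s)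
      (by rw [f]; omega) (by rw [f]; omega) (by rw [f]; omega) (by rw [f]; omega) hz hz').2
    rw [f] at this
    omega

end MeetProperly

set_option maxHeartbeats 1000000 in
/-- The drawing of a single block of `H_d`, the triangles `u a a'` and `v a a'` together with their
inner vertices `b` and `c`. -/
theorem pairwise_meetProperly_block {V : Type} {P : V → ℤ × ℤ} {u v a a' b c : V} {X Y : ℤ}
    (hX : 1 ≤ X) (hXY : 2 * X + 3 ≤ Y) (hu : P u = (0, 1)) (hv : P v = (0, 4))
    (h : (P a = (X, 2) ∧ P a' = (Y, 3) ∧ P b = (X + 1, 2) ∧ P c = (Y - 1, 3)) ∨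
      (P a = (X, 3) ∧ P a' = (Y, 2) ∧ P b = (Y - 1, 2) ∧ P c = (X + 1, 3))) :
    [(u, v), (u, a), (v, a), (u, a'), (v, a'), (a, a'), (b, u), (b, a), (b, a'), (c, v), (c, a),
      (c, a')].Pairwise (MeetProperly P) := by
  simp only [List.pairwise_cons, List.forall_mem_cons, List.not_mem_nil, false_imp_iff,
    implies_true, and_true, List.Pairwise.nil]
  rcases h with ⟨ha, ha', hb, hc⟩ | ⟨ha, ha', hb, hc⟩ <;>
  refine ⟨⟨?_, ?_, ?_, ?_, ?_, ?_, ?_, ?_, ?_, ?_, ?_⟩, ⟨?_, ?_, ?_, ?_, ?_, ?_, ?_, ?_, ?_, ?_⟩,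
    ⟨?_, ?_, ?_, ?_, ?_, ?_, ?_, ?_, ?_⟩, ⟨?_, ?_, ?_, ?_, ?_, ?_, ?_, ?_⟩,
    ⟨?_, ?_, ?_, ?_, ?_, ?_, ?_⟩, ⟨?_, ?_, ?_, ?_, ?_, ?_⟩, ⟨?_, ?_, ?_, ?_, ?_⟩,
    ⟨?_, ?_, ?_, ?_⟩, ⟨?_, ?_, ?_⟩, ⟨?_, ?_⟩, ?_⟩ <;>
  first
  | refine .of_common ?_
    simp only [orient, hu, hv, ha, ha', hb, hc]
    omega
  | refine .swap_left (.of_common ?_)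
    simp only [orient, hu, hv, ha, ha', hb, hc]
    omega
  | refine .swap_right (.of_common ?_)
    simp only [orient, hu, hv, ha, ha', hb, hc]
    omega
  | refine .swap_left (.swap_right (.of_common ?_))
    simp only [orient, hu, hv, ha, ha', hb, hc]
    omega
  | refine .of_sameSide ?_
    simp only [orient, hu, hv, ha, ha', hb, hc]
    omega
  | refine .symm (.of_sameSide ?_)
    simp only [orient, hu, hv, ha, ha', hb, hc]
    omega

/-- The column of the path vertex `a_i` in the drawing of height 4. -/
def col (i : ℕ) : ℤ := 4 ^ (i + 1)

theorem col_succ (i : ℕ) : col (i + 1) = 4 * col i := by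
  simp only [col]; ring

theorem four_le_col (i : ℕ) : 4 ≤ col i := by
  induction i with
  | zero => simp [col]
  | succ i ih => rw [col_succ]; omega

theorem four_dvd_col (i : ℕ) : 4 ∣ col i := ⟨4 ^ i, by simp only [col]; ring⟩

theorem col_strictMono : StrictMono col :=
  strictMono_nat_of_lt_succ fun i => by
    have := four_le_col i
    rw [col_succ]; omega

theorem four_mul_col_le {i j : ℕ} (h : i < j) : 4 * col i ≤ col j := by
  rw [← col_succ]
  exact col_strictMono.monotone h

/-- The vertex positions of a planar grid drawing of `H_d` of height 4. -/
def gridPos {d : ℕ} : HVert d → ℤ × ℤ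
  | .u => (0, 1)
  | .v => (0, 4)
  | .a i => (col i, if Even (i : ℕ) then 2 else 3)
  | .b i => (if Even (i : ℕ) then col i + 1 else col (i + 1) - 1, 2)
  | .c i => (if Even (i : ℕ) then col (i + 1) - 1 else col i + 1, 3)

theorem gridPos_injective {d : ℕ} : Function.Injective (gridPos (d := d)) := by
  have inj : ∀ i j : ℕ, col i = col j → i = j := fun i j h => col_strictMono.injective h
  have off : ∀ i j : ℕ, col i + 1 ≠ col (j + 1) - 1 := fun i j h => by
    have := four_dvd_col i
    have := four_dvd_col (j + 1)
    omega
  have bc : ∀ i j : Fin (d - 1), (if Even (i : ℕ) then col i + 1 else col (i + 1) - 1) =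
      (if Even (j : ℕ) then col j + 1 else col (j + 1) - 1) → i = j := by
    intro i j h
    split_ifs at h
    · exact Fin.ext (inj _ _ (by omega))
    · exact absurd h (off _ _)
    · exact absurd h.symm (off _ _)
    · exact Fin.ext (by simpa using inj (i + 1) (j + 1) (by omega))
  have cb : ∀ i j : Fin (d - 1), (if Even (i : ℕ) then col (i + 1) - 1 else col i + 1) =
      (if Even (j : ℕ) then col (j + 1) - 1 else col j + 1) → i = j := by
    intro i j h
    split_ifs at h
    · exact Fin.ext (by simpa using inj (i + 1) (j + 1) (by omega))
    · exact absurd h.symm (off _ _)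
    · exact absurd h (off _ _)
    · exact Fin.ext (inj _ _ (by omega))
  have dvd : ∀ i : Fin d, 4 ∣ col i := fun i => four_dvd_col i
  have dvd' : ∀ i : Fin (d - 1), 4 ∣ col i ∧ 4 ∣ col (i + 1) := fun i =>
    ⟨four_dvd_col i, four_dvd_col (i + 1)⟩
  intro p q h
  rcases p with _ | _ | i | i | i <;> rcases q with _ | _ | j | j | j <;>
    simp only [gridPos, Prod.mk.injEq] at h <;> obtain ⟨h1, h2⟩ := h
  all_goals first
    | rfl
    | exact congrArg _ (bc _ _ h1)
    | exact congrArg _ (cb _ _ h1)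
    | exact congrArg _ (Fin.ext (inj _ _ h1))
    | omega
    | have := dvd i
      have := dvd' j
      split_ifs at h1 <;> omega
    | have := dvd' i
      have := dvd j
      split_ifs at h1 <;> omega

/-- The layer of the triangles in which a vertex is added. -/
def layer {d : ℕ} : HVert d → ℕ
  | .u => 0
  | .v => 0
  | .a i => i
  | .b i => i + 1
  | .c i => i + 1

/-- The vertices up to layer `i` other than `u`, `v`, `a_i`. -/
theorem gridPos_of_layer_le {d : ℕ} {w : HVert d} {i : ℕ} (hi : i < d) (hw : layer w ≤ i) :
    w = .u ∨ w = .v ∨ w = .a ⟨i, hi⟩ ∨ 0 ≤ (gridPos w).1 ∧ (gridPos w).1 < col i ∧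
      ((gridPos w).2 = 2 ∧ (Even i ∨ 2 * (gridPos w).1 ≤ col i) ∨
        (gridPos w).2 = 3 ∧ (¬ Even i ∨ 2 * (gridPos w).1 ≤ col i)) := by
  rcases w with _ | _ | j | j | j
  · simp
  · simp
  · simp only [layer] at hw
    rcases hw.eq_or_lt with h | h
    · simp [← h]
    · have h1 := four_mul_col_le h
      have h2 := four_le_col j
      simp only [gridPos]
      right; right; right
      split_ifs <;> simp <;> omega
  · have h1 := four_le_col j
    have h2 := col_succ j
    rcases hw.eq_or_lt with rfl | h
    · simp only [gridPos, layer, Nat.even_add_one]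
      split_ifs with hj <;> simp [hj] <;> omega
    · have h3 := four_mul_col_le h
      simp only [gridPos, layer] at *
      split_ifs <;> simp <;> omega
  · have h1 := four_le_col j
    have h2 := col_succ j
    rcases hw.eq_or_lt with rfl | h
    · simp only [gridPos, layer, Nat.even_add_one]
      split_ifs with hj <;> simp [hj] <;> omega
    · have h3 := four_mul_col_le h
      simp only [gridPos, layer] at *
      split_ifs <;> simp <;> omega

theorem orient_nonpos_of_layer_le {d : ℕ} {w : HVert d} {i : ℕ} (hi : i < d) (hw : layer w ≤ i) :
    orient (gridPos (.a ⟨i, hi⟩)) (gridPos (.u : HVert d)) (gridPos w) ≤ 0 ∧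
      orient (gridPos (.v : HVert d)) (gridPos (.a ⟨i, hi⟩)) (gridPos w) ≤ 0 := by
  have h4 := four_le_col i
  rcases gridPos_of_layer_le hi hw with rfl | rfl | rfl | ⟨h0, h1, h⟩
  · simp only [gridPos, orient]; split_ifs <;> omega
  · simp only [gridPos, orient]; split_ifs <;> omega
  · simp only [gridPos, orient]; split_ifs <;> omega
  · generalize gridPos w = x at *
    obtain ⟨x, y⟩ := x
    simp only at *
    rcases h with ⟨rfl, h⟩ | ⟨rfl, h⟩ <;> simp only [gridPos, orient] <;> split_ifs with he <;>
      simp only [he, not_true, not_false_iff, true_or, false_or] at h <;> constructor <;> omega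

theorem orient_pos_of_layer_eq {d : ℕ} {w : HVert d} {i : ℕ} (hi : i < d) (hw : layer w = i + 1) :
    0 < orient (gridPos (.a ⟨i, hi⟩)) (gridPos (.u : HVert d)) (gridPos w) ∧
      0 < orient (gridPos (.v : HVert d)) (gridPos (.a ⟨i, hi⟩)) (gridPos w) := by
  have h4 := four_le_col i
  have h5 := col_succ i
  rcases w with _ | _ | j | j | j <;> simp only [layer] at hw
  · omega
  · omega
  · simp only [gridPos, orient, hw, Nat.even_add_one, h5]
    split_ifs <;> simp_all <;> omega
  · obtain rfl : (j : ℕ) = i := by omega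
    simp only [gridPos, orient, h5]
    split_ifs <;> constructor <;> omega
  · obtain rfl : (j : ℕ) = i := by omega
    simp only [gridPos, orient, h5]
    split_ifs <;> constructor <;> omega

theorem end_of_layer_le {d : ℕ} {p q : HVert d} {i : ℕ} (hi : i < d) (h : (Hgraph d).Adj p q)
    (hpq : layer p ≤ layer q) (hq : layer q = i + 1) :
    p = .u ∨ p = .v ∨ p = .a ⟨i, hi⟩ ∨ layer p = i + 1 := by
  rcases p with _ | _ | j | j | j <;> rcases q with _ | _ | k | k | k <;>
    simp [Hgraph, HRel, layer, Fin.ext_iff] at * <;> omega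

theorem eq_or_eq_of_mem_segment {d : ℕ} {p r s : HVert d} {i : ℕ} (hi : i < d)
    (hp : p = .u ∨ p = .v ∨ p = .a ⟨i, hi⟩) (hr : layer r ≤ i) (hs : layer s ≤ i)
    (h : toPt (gridPos p) ∈ segment ℝ (toPt (gridPos r)) (toPt (gridPos s))) :
    p = r ∨ p = s := by
  have h4 := four_le_col i
  have key : ∃ α β : ℤ, ∀ w : HVert d, layer w ≤ i →
      α * (gridPos w).1 + β * (gridPos w).2 < α * (gridPos p).1 + β * (gridPos p).2 ∨
        gridPos p = gridPos w := by
    rcases hp with rfl | rfl | rfl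
    · refine ⟨0, -1, fun w hw => ?_⟩
      rcases gridPos_of_layer_le hi hw with rfl | rfl | rfl | ⟨h0, h1, h⟩
      · exact Or.inr rfl
      · simp [gridPos]
      · left; simp only [gridPos]; split_ifs <;> omega
      · left; generalize gridPos w = x at *; simp only [gridPos]; omega
    · refine ⟨0, 1, fun w hw => ?_⟩
      rcases gridPos_of_layer_le hi hw with rfl | rfl | rfl | ⟨h0, h1, h⟩
      · simp [gridPos]
      · exact Or.inr rfl
      · left; simp only [gridPos]; split_ifs <;> omega
      · left; generalize gridPos w = x at *; simp only [gridPos]; omega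
    · refine ⟨1, 0, fun w hw => ?_⟩
      rcases gridPos_of_layer_le hi hw with rfl | rfl | rfl | ⟨h0, h1, h⟩
      · left; simp only [gridPos]; omega
      · left; simp only [gridPos]; omega
      · exact Or.inr rfl
      · left; simp only [gridPos] at *; omega
  obtain ⟨α, β, hw⟩ := key
  exact (eq_or_eq_of_extreme α β (hw r hr) (hw s hs) h).imp (@gridPos_injective d _ _)
    (@gridPos_injective d _ _)

theorem meetProperly_of_layer_le {d : ℕ} {p q r s : HVert d} {i : ℕ} (h : (Hgraph d).Adj p q)
    (hi : i < d) (hpq : layer p ≤ layer q) (hq : layer q = i + 1) (hr : layer r ≤ i)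
    (hs : layer s ≤ i) : MeetProperly gridPos (p, q) (r, s) := by
  refine ⟨fun z hz hz' => ?_⟩
  have nr := orient_nonpos_of_layer_le hi hr
  have ns := orient_nonpos_of_layer_le hi hs
  have nq := orient_pos_of_layer_eq hi hq
  have e := end_of_layer_le hi h hpq hq
  have key : z = toPt (gridPos p) ∧ (p = .u ∨ p = .v ∨ p = .a ⟨i, hi⟩) := by
    by_cases hv : p = .v
    · have hp : orient (gridPos (.v : HVert d)) (gridPos (.a ⟨i, hi⟩)) (gridPos p) = 0 := by
        subst hv; simp only [orient]; ring
      exact ⟨(eq_of_separated _ _ hp.ge nq.2 nr.2 ns.2 hz hz').1, Or.inr (Or.inl hv)⟩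
    · have hp : 0 < orient (gridPos (.a ⟨i, hi⟩)) (gridPos (.u : HVert d)) (gridPos p) ∨
          orient (gridPos (.a ⟨i, hi⟩)) (gridPos (.u : HVert d)) (gridPos p) = 0 ∧
            (p = .u ∨ p = .v ∨ p = .a ⟨i, hi⟩) := by
        rcases e with rfl | rfl | rfl | e
        · right; simp only [orient, true_or, and_true]; ring
        · exact absurd rfl hv
        · right; simp only [orient, or_true, and_true]; ring
        · exact Or.inl (orient_pos_of_layer_eq hi e).1
      have sep := eq_of_separated _ _ (hp.elim le_of_lt fun h => h.1.ge) nq.1 nr.1 ns.1 hz hz'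
      exact ⟨sep.1, (hp.resolve_left sep.2.not_gt).2⟩
  obtain ⟨rfl, hp⟩ := key
  exact ⟨p, Or.inl rfl, eq_or_eq_of_mem_segment hi hp hr hs hz', rfl⟩

/-- The edges of the subgraph of `H_d` induced by `u`, `v`, `a_i`, `a_{i+1}`, `b_i` and `c_i`. -/
def blockEdges {d i : ℕ} (hi : i + 1 < d) : List (HVert d × HVert d) :=
  let a : HVert d := .a ⟨i, by omega⟩
  let a' : HVert d := .a ⟨i + 1, hi⟩
  let b : HVert d := .b ⟨i, by omega⟩
  let c : HVert d := .c ⟨i, by omega⟩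
  [(.u, .v), (.u, a), (.v, a), (.u, a'), (.v, a'), (a, a'), (b, .u), (b, a), (b, a'), (c, .v),
    (c, a), (c, a')]

theorem pairwise_blockEdges {d i : ℕ} (hi : i + 1 < d) :
    (blockEdges hi).Pairwise (MeetProperly gridPos) := by
  have h4 := four_le_col i
  have h5 := col_succ i
  refine pairwise_meetProperly_block (X := col i) (Y := col (i + 1)) (by omega) (by omega) rfl rfl
    ?_
  by_cases h : Even i <;> simp [gridPos, h, Nat.even_add_one]

theorem mem_blockEdges_of_layer {d i : ℕ} {p q : HVert d} (hi : i + 1 < d)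
    (h : (Hgraph d).Adj p q) (hpq : layer p ≤ layer q)
    (hq : layer q = i + 1 ∨ layer q = 0 ∧ i = 0) :
    (p, q) ∈ blockEdges hi ∨ (q, p) ∈ blockEdges hi := by
  rcases p with _ | _ | j | j | j <;> rcases q with _ | _ | k | k | k <;>
    simp [Hgraph, HRel, layer, Fin.ext_iff, blockEdges] at * <;> omega

theorem meetProperly_of_mem {d i : ℕ} (hi : i + 1 < d) {e f : HVert d × HVert d}
    (he : e ∈ blockEdges hi) (hf : f ∈ blockEdges hi) (hne : e ≠ f) :
    MeetProperly gridPos e f :=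
  have : Std.Symm (MeetProperly (gridPos (d := d))) := ⟨fun _ _ h => h.symm⟩
  (pairwise_blockEdges hi).forall he hf hne

theorem meetProperly_of_layer_eq {d i : ℕ} {p q r s : HVert d} (hi : i + 1 < d)
    (h : (Hgraph d).Adj p q) (h' : (Hgraph d).Adj r s) (hne : s(p, q) ≠ s(r, s))
    (hpq : layer p ≤ layer q) (hrs : layer r ≤ layer s)
    (hq : layer q = i + 1 ∨ layer q = 0 ∧ i = 0) (hs : layer s = i + 1 ∨ layer s = 0 ∧ i = 0) :
    MeetProperly gridPos (p, q) (r, s) := by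
  have ne1 : (p, q) ≠ (r, s) := fun e => hne (by simp_all)
  have ne2 : (p, q) ≠ (s, r) := fun e => hne (by simp_all)
  rcases mem_blockEdges_of_layer hi h hpq hq with m | m <;>
    rcases mem_blockEdges_of_layer hi h' hrs hs with m' | m'
  · exact meetProperly_of_mem hi m m' ne1
  · exact (meetProperly_of_mem hi m m' ne2).swap_right
  · exact (meetProperly_of_mem hi m m' fun e => ne2 (Prod.swap_inj.1 e)).swap_left
  · exact (meetProperly_of_mem hi m m' fun e => ne1 (Prod.swap_inj.1 e)).swap_left.swap_right

theorem layer_lt {d : ℕ} (hd : 0 < d) (w : HVert d) : layer w < d := by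
  rcases w with _ | _ | j | j | j <;> simp only [layer] <;> omega

theorem meetProperly_of_adj {d : ℕ} (hd : 2 ≤ d) {p q r s : HVert d} (h : (Hgraph d).Adj p q)
    (h' : (Hgraph d).Adj r s) (hne : s(p, q) ≠ s(r, s)) :
    MeetProperly gridPos (p, q) (r, s) := by
  wlog hpq : layer p ≤ layer q generalizing p q
  · exact (this h.symm (by rwa [Sym2.eq_swap]) (le_of_not_ge hpq)).swap_left
  wlog hrs : layer r ≤ layer s generalizing r s
  · exact (this h'.symm (by rwa [Sym2.eq_swap (a := s)]) (le_of_not_ge hrs)).swap_right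
  wlog hqs : layer s ≤ layer q generalizing p q r s
  · exact (this h' hrs h hne.symm hpq (le_of_not_ge hqs)).symm
  have hq := layer_lt (by omega) q
  rcases Nat.eq_zero_or_eq_succ_pred (layer q) with h0 | h0
  · exact meetProperly_of_layer_eq (i := 0) (by omega) h h' hne hpq hrs (by omega) (by omega)
  · rcases hqs.eq_or_lt with e | e
    · exact meetProperly_of_layer_eq (i := (layer q).pred) (by omega) h h' hne hpq hrs (by omega)
        (by omega)
    · exact meetProperly_of_layer_le (i := (layer q).pred) h (by omega) hpq h0 (by omega)
        (by omega)

theorem exists_planar_drawing {d : ℕ} (hd : 2 ≤ d) :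
    ∃ Γ : StraightDrawing (Hgraph d), Γ.IsPlanar ∧ Γ.IsGrid ∧ Γ.HeightLe 4 := by
  have inj : Function.Injective fun w : HVert d => toPt (gridPos w) := by
    intro p q h
    simp only [toPt, Prod.mk.injEq, Int.cast_inj] at h
    exact gridPos_injective (Prod.ext h.1 h.2)
  let Γ : StraightDrawing (Hgraph d) := ⟨_, inj⟩
  have meet : ∀ e ∈ (Hgraph d).edgeSet, ∀ f ∈ (Hgraph d).edgeSet, e ≠ f →
      ∀ z ∈ Γ.edgePts e ∩ Γ.edgePts f,
        ∃ w, w ∈ e ∧ w ∈ f ∧ z = toPt (gridPos w) := by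
    intro e he f hf
    induction e with | _ p q
    induction f with | _ r s
    intro hne z hz
    obtain ⟨w, h1, h2, h3⟩ := (meetProperly_of_adj hd he hf hne).exists_common z hz.1 hz.2
    exact ⟨w, Sym2.mem_iff.2 h1, Sym2.mem_iff.2 h2, h3⟩
  refine ⟨Γ, ⟨?_, meet⟩, fun w => ⟨gridPos w, rfl⟩, fun w => ⟨(gridPos w).2, ?_, ?_, rfl⟩⟩
  · intro w e he hwe hw
    obtain ⟨x, hx⟩ : ∃ x, (Hgraph d).Adj w x := by
      rcases w with _ | _ | j | j | j
      · exact ⟨.v, by simp [Hgraph, HRel]⟩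
      · exact ⟨.u, by simp [Hgraph, HRel]⟩
      · exact ⟨.u, by simp [Hgraph, HRel]⟩
      · exact ⟨.u, by simp [Hgraph, HRel]⟩
      · exact ⟨.v, by simp [Hgraph, HRel]⟩
    obtain ⟨y, h1, -, h3⟩ := meet e he s(w, x) hx (fun h => hwe (h ▸ Sym2.mem_mk_left w x)) _
      ⟨hw, left_mem_segment ℝ _ _⟩
    exact hwe (inj h3 ▸ h1)
  · rcases w with _ | _ | j | j | j <;> simp only [gridPos] <;> (try split_ifs) <;> norm_num
  · rcases w with _ | _ | j | j | j <;> simp only [gridPos] <;> (try split_ifs) <;> norm_num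

/-- For every `d ≥ 11`, the graph `H_d` (on `n = 3d` vertices) admits
a planar straight-line grid drawing of height 4 but none of height at most 3; hence
every planar straight-line grid drawing of `H_d` of minimum height (namely height 4)
has area (width times height) at least `(4/3)·2^d`, which is exponential in `n`. -/
theorem stmt8 (d : ℕ) (hd : 11 ≤ d) :
    (∃ Γ : StraightDrawing (Hgraph d), Γ.IsPlanar ∧ Γ.IsGrid ∧ Γ.HeightLe 4) ∧
    (¬ ∃ Γ : StraightDrawing (Hgraph d), Γ.IsPlanar ∧ Γ.IsGrid ∧ Γ.HeightLe 3) ∧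
    (∀ Γ : StraightDrawing (Hgraph d), Γ.IsPlanar → Γ.IsGrid → Γ.HeightLe 4 →
      ∃ w₁ w₂ : HVert d,
        (4 / 3 : ℝ) * 2 ^ d ≤ ((Γ.pos w₁).1 - (Γ.pos w₂).1 + 1) * 4) := by
  exact ⟨exists_planar_drawing (by omega), not_heightLe_three hd, fun Γ hp hg hh =>
    exists_exponential_width hd hp hg hh⟩
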